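/- There are infinitely many Carmichael numbers n such that the number of distinct prime factors of n is a perfect square, i.e., ω(n) = m² for some natural number m. (This statement is unconditional.) -/

import Mathlib

/-- A Carmichael number: a composite `n > 1` dividing `a^n - a` for every integer `a`. -/
def IsCarmichael (n : ℕ) : Prop :=
  1 < n ∧ ¬ n.Prime ∧ ∀ a : ℤ, (n : ℤ) ∣ a ^ n - a

namespace Carm
open Complex

lemma cpow_sub_le {x y : ℝ} (hy : 0 < y) (hxy : y ≤ x) {s : ℂ} (hs : 0 < s.re) :
    ‖((x : ℂ) ^ (-s)) - ((y : ℂ) ^ (-s))‖ ≤ ‖s‖ * y ^ (-s.re - 1) * (x - y) := by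
  have hs0 : -s ≠ 0 := by
    intro h; have := congrArg Complex.re h; simp at this; linarith
  have := Convex.norm_image_sub_le_of_norm_hasDerivWithin_le (𝕜 := ℝ) (s := Set.Icc y x)
    (f := fun u : ℝ => (u : ℂ) ^ (-s)) (f' := fun u : ℝ => (-s) * (u : ℂ) ^ (-s - 1))
    (C := ‖s‖ * y ^ (-s.re - 1)) (x := y) (y := x) ?_ ?_ (convex_Icc y x)
    ⟨le_refl _, hxy⟩ ⟨hxy, le_refl _⟩
  · rwa [Real.norm_eq_abs, abs_of_nonneg (by linarith)] at this
  · intro u hu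
    exact (hasDerivAt_ofReal_cpow_const (by linarith [hu.1]) hs0).hasDerivWithinAt
  · intro u hu
    have hu0 : 0 < u := by linarith [hu.1]
    rw [norm_mul, norm_neg, Complex.norm_cpow_eq_rpow_re_of_pos hu0]
    simp only [sub_re, neg_re, one_re]
    have := Real.rpow_le_rpow_of_nonpos (z := -s.re - 1) hy hu.1 (by linarith)
    gcongr

noncomputable def blk {m : ℕ} [NeZero m] (χ : DirichletCharacter ℂ m) (n : ℕ) (s : ℂ) : ℂ :=
  ∑ a : ZMod m, χ a * (((a.val + m * n : ℕ) : ℂ) ^ (-s))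

lemma blk_diff {m : ℕ} [NeZero m] (hm : 1 < m) (χ : DirichletCharacter ℂ m) (n : ℕ) :
    Differentiable ℂ (blk χ n) := by
  unfold blk
  have : Fact (1 < m) := ⟨hm⟩
  refine Differentiable.fun_sum fun a _ => ?_
  by_cases ha : a = 0
  · subst ha
    rw [MulChar.map_zero]; simp
  · have : ((a.val + m * n : ℕ) : ℂ) ≠ 0 := by
      have : a.val ≠ 0 := by simpa using ha
      exact_mod_cast (by omega : a.val + m * n ≠ 0)
    refine (differentiable_const _).mul ?_
    exact fun s => (differentiableAt_id.neg).const_cpow (Or.inl this)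

lemma blk_bound {m : ℕ} [NeZero m] {χ : DirichletCharacter ℂ m} (hχ : χ ≠ 1) {n : ℕ} (hn : 1 ≤ n)
    {s : ℂ} (hs : 0 < s.re) :
    ‖blk χ n s‖ ≤ ‖s‖ * (m : ℝ) ^ (1 - s.re) * (n : ℝ) ^ (- s.re - 1) := by
  have hm0 : (0 : ℝ) < m := by exact_mod_cast (NeZero.pos m)
  have hn0 : (0 : ℝ) < n := by exact_mod_cast hn
  have h0 : blk χ n s = ∑ a : ZMod m, χ a *
      ((((a.val + m * n : ℝ) : ℂ) ^ (-s)) - (((m * n : ℝ) : ℂ) ^ (-s))) := by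
    simp_rw [mul_sub, Finset.sum_sub_distrib, ← Finset.sum_mul, MulChar.sum_eq_zero_of_ne_one hχ]
    simp only [blk, zero_mul, sub_zero]
    push_cast
    rfl
  rw [h0]
  have : ∀ a : ZMod m, ‖χ a *
      ((((a.val + m * n : ℝ) : ℂ) ^ (-s)) - (((m * n : ℝ) : ℂ) ^ (-s)))‖ ≤
      ‖s‖ * (m * n : ℝ) ^ (-s.re - 1) * m := by
    intro a
    rw [norm_mul]
    have h1 := cpow_sub_le (x := a.val + m * n) (y := m * n) (by positivity)
      (by linarith [Nat.cast_nonneg (α := ℝ) a.val]) hs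
    have h2 : (a.val : ℝ) ≤ m := by exact_mod_cast (ZMod.val_lt a).le
    calc _ ≤ 1 * (‖s‖ * (m * n : ℝ) ^ (-s.re - 1) * (a.val + m * n - m * n)) := by
          gcongr
          exact χ.norm_le_one a
      _ ≤ _ := by
          rw [one_mul, add_sub_cancel_right]; gcongr
  refine (norm_sum_le _ _).trans ((Finset.sum_le_sum fun a _ => this a).trans ?_)
  rw [Finset.sum_const, Finset.card_univ, ZMod.card, nsmul_eq_mul, Real.mul_rpow hm0.le hn0.le]
  have : (m : ℝ) ^ (1 - s.re) = m * m * (m : ℝ) ^ (-s.re - 1) := by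
    rw [show 1 - s.re = 1 + 1 + (-s.re - 1) by ring, Real.rpow_add hm0, Real.rpow_add hm0,
      Real.rpow_one]
  rw [this]
  apply le_of_eq; ring

lemma summ32 : Summable (fun n : ℕ => (n : ℝ) ^ (-(3 / 2) : ℝ)) := by
  rw [Real.summable_nat_rpow]; norm_num

noncomputable def c32 : ℝ := ∑' n : ℕ, (n : ℝ) ^ (-(3 / 2) : ℝ)

lemma c32_nonneg : 0 ≤ c32 := tsum_nonneg fun n => by positivity

lemma LSeries_eq_tsum_blk {m : ℕ} [NeZero m] (hm : 1 < m) (χ : DirichletCharacter ℂ m) {s : ℂ}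
    (hs : 1 < s.re) : LSeries (fun n => χ n) s = ∑' n, blk χ n s := by
  have : Fact (1 < m) := ⟨hm⟩
  have hsum := χ.LSeriesSummable_of_one_lt_re hs
  have hterm : ∀ n : ℕ, LSeries.term (fun n => χ n) s n = χ n * (n : ℂ) ^ (-s) := by
    intro n
    rw [LSeries.term_def]
    split_ifs with h
    · subst h; rw [Nat.cast_zero, MulChar.map_zero, zero_mul]
    · rw [cpow_neg, div_eq_mul_inv]
  rw [LSeries, Nat.sumByResidueClasses hsum m]
  rw [← Summable.tsum_finsetSum]
  · refine tsum_congr fun n => ?_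
    unfold blk
    refine Finset.sum_congr rfl fun a _ => ?_
    rw [hterm]
    simp
  · intro a _
    refine hsum.comp_injective (i := fun n => a.val + m * n) ?_
    intro x y hxy
    have hm0 := NeZero.pos m
    simpa [hm0.ne'] using hxy

lemma LFunction_eq_tsum_blk {m : ℕ} [NeZero m] (hm : 1 < m) {χ : DirichletCharacter ℂ m}
    (hχ : χ ≠ 1) {s : ℂ} (hs : s ∈ Metric.ball (1 : ℂ) (1 / 2)) :
    χ.LFunction s = ∑' n, blk χ n s := by
  have hm0 : (1 : ℝ) ≤ m := by exact_mod_cast hm.le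
  have hre : ∀ w ∈ Metric.ball (1 : ℂ) (1 / 2), 1 / 2 ≤ w.re ∧ ‖w‖ ≤ 3 / 2 := by
    intro w hw
    rw [mem_ball_iff_norm] at hw
    have h1 := (abs_le.1 ((abs_re_le_norm (w - 1)).trans hw.le)).1
    simp at h1
    refine ⟨by linarith, ?_⟩
    have := norm_add_le (w - 1) 1
    simp at this; linarith
  have hd : DifferentiableOn ℂ (fun w => ∑' n, blk χ n w) (Metric.ball (1 : ℂ) (1 / 2)) := by
    have hd1 : DifferentiableOn ℂ (fun w => ∑' n, blk χ (n + 1) w) (Metric.ball (1 : ℂ) (1 / 2)) := by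
      refine differentiableOn_tsum_of_summable_norm
        (u := fun n => 3 / 2 * (m : ℝ) * ((n + 1 : ℕ) : ℝ) ^ (-(3 / 2) : ℝ))
        (((summable_nat_add_iff 1).2 summ32).mul_left _)
        (fun n => (blk_diff hm χ _).differentiableOn) Metric.isOpen_ball ?_
      intro n w hw
      obtain ⟨h1, h2⟩ := hre w hw
      refine (blk_bound hχ (by omega) (by linarith)).trans ?_
      have h3 : (m : ℝ) ^ (1 - w.re) ≤ m := by
        calc (m : ℝ) ^ (1 - w.re) ≤ (m : ℝ) ^ (1 : ℝ) :=
              Real.rpow_le_rpow_of_exponent_le hm0 (by linarith)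
          _ = m := Real.rpow_one _
      have h4 : ((n + 1 : ℕ) : ℝ) ^ (-w.re - 1) ≤ ((n + 1 : ℕ) : ℝ) ^ (-(3 / 2) : ℝ) := by
        apply Real.rpow_le_rpow_of_exponent_le
        · push_cast; linarith [Nat.cast_nonneg (α := ℝ) n]
        · linarith
      gcongr
    have : Set.EqOn (fun w => ∑' n, blk χ n w) (fun w => blk χ 0 w + ∑' n, blk χ (n + 1) w)
        (Metric.ball (1 : ℂ) (1 / 2)) := by
      intro w hw
      obtain ⟨h1, h2⟩ := hre w hw
      refine Summable.tsum_eq_zero_add ?_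
      rw [← summable_nat_add_iff 1]
      refine Summable.of_norm_bounded (g := fun n => 3 / 2 * (m : ℝ) * ((n + 1 : ℕ) : ℝ) ^ (-(3 / 2) : ℝ))
        (((summable_nat_add_iff 1).2 summ32).mul_left _) ?_
      intro n
      refine (blk_bound hχ (by omega) (by linarith)).trans ?_
      have h3 : (m : ℝ) ^ (1 - w.re) ≤ m := by
        calc (m : ℝ) ^ (1 - w.re) ≤ (m : ℝ) ^ (1 : ℝ) :=
              Real.rpow_le_rpow_of_exponent_le hm0 (by linarith)
          _ = m := Real.rpow_one _
      have h4 : ((n + 1 : ℕ) : ℝ) ^ (-w.re - 1) ≤ ((n + 1 : ℕ) : ℝ) ^ (-(3 / 2) : ℝ) := by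
        apply Real.rpow_le_rpow_of_exponent_le
        · push_cast; linarith [Nat.cast_nonneg (α := ℝ) n]
        · linarith
      gcongr
    exact (DifferentiableOn.add (blk_diff hm χ 0).differentiableOn hd1).congr this
  have key := AnalyticOnNhd.eqOn_of_preconnected_of_eventuallyEq
    (((DirichletCharacter.differentiable_LFunction hχ).differentiableOn
      (s := Metric.ball (1 : ℂ) (1 / 2))).analyticOnNhd Metric.isOpen_ball)
    (hd.analyticOnNhd Metric.isOpen_ball) (convex_ball _ _).isPreconnected
    (z₀ := ((5 / 4 : ℝ) : ℂ)) ?_ ?_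
  · exact key hs
  · rw [mem_ball_iff_norm, ← ofReal_one, ← ofReal_sub, norm_real]; norm_num
  · have : {w : ℂ | 1 < w.re} ∈ nhds ((5 / 4 : ℝ) : ℂ) :=
      (isOpen_lt continuous_const continuous_re).mem_nhds (by simp; norm_num)
    filter_upwards [this] with w hw
    rw [DirichletCharacter.LFunction_eq_LSeries χ hw, LSeries_eq_tsum_blk hm χ hw]

noncomputable def C0 : ℝ := 200 + 10 * c32

lemma C0_ge : 200 ≤ C0 := by have := c32_nonneg; unfold C0; linarith

/-- Upper bound for L-functions close to 1. -/
lemma LFunction_bound {m : ℕ} [NeZero m] {χ : DirichletCharacter ℂ m} (hχ : χ ≠ 1) {V : ℝ}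
    (hV : C0 * (1 + Real.log m) ≤ V) {s : ℂ} (hs : ‖s - 1‖ ≤ 2 / V) : ‖χ.LFunction s‖ ≤ V := by
  have hm : 1 < m := by
    by_contra h
    have h1 : m = 1 := by have := NeZero.pos m; omega
    subst h1
    exact hχ (DirichletCharacter.level_one χ)
  have : Fact (1 < m) := ⟨hm⟩
  have hm0 : (1 : ℝ) ≤ m := by exact_mod_cast hm.le
  have hlog : 0 ≤ Real.log m := Real.log_nonneg hm0
  have hC := C0_ge
  have hV2 : 200 ≤ V := by nlinarith
  have hs' : ‖s - 1‖ ≤ 1 / 100 := hs.trans (by rw [div_le_div_iff₀ (by linarith) (by norm_num)]; linarith)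
  have hball : s ∈ Metric.ball (1 : ℂ) (1 / 2) := by rw [mem_ball_iff_norm]; linarith
  have h1 := abs_le.1 (abs_re_le_norm (s - 1))
  simp only [sub_re, one_re] at h1
  have hns : ‖s‖ ≤ 3 / 2 := by
    have := norm_add_le (s - 1) 1
    simp at this; linarith
  have hexp : ∀ x : ℝ, 1 ≤ x → x ≤ m → x ^ (1 - s.re) ≤ 2 := by
    intro x hx1 hxm
    have hl : 0 ≤ Real.log x := Real.log_nonneg hx1
    have hl2 : Real.log x ≤ Real.log m := Real.log_le_log (by linarith) hxm
    rw [Real.rpow_def_of_pos (by linarith)]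
    calc Real.exp (Real.log x * (1 - s.re)) ≤ Real.exp (1 / 2) := by
          apply Real.exp_le_exp.2
          have h3 : Real.log x * (1 - s.re) ≤ Real.log m * (2 / V) := by
            calc _ ≤ Real.log x * (2 / V) := by gcongr; linarith
              _ ≤ _ := by gcongr
          have h4 : Real.log m * (2 / V) ≤ 1 / 2 := by
            rw [mul_div_assoc', div_le_iff₀ (by linarith)]
            nlinarith
          linarith
      _ ≤ 2 := by
          have := Real.exp_one_lt_d9
          have h5 : Real.exp (1 / 2) * Real.exp (1 / 2) = Real.exp 1 := by rw [← Real.exp_add]; norm_num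
          nlinarith [Real.exp_pos (1 / 2)]
  have hb1 : ∀ n : ℕ, ‖blk χ (n + 1) s‖ ≤ 5 * ((n + 1 : ℕ) : ℝ) ^ (-(3 / 2) : ℝ) := by
    intro n
    refine (blk_bound hχ (by omega) (by linarith)).trans ?_
    have h4 : ((n + 1 : ℕ) : ℝ) ^ (-s.re - 1) ≤ ((n + 1 : ℕ) : ℝ) ^ (-(3 / 2) : ℝ) := by
      apply Real.rpow_le_rpow_of_exponent_le
      · push_cast; linarith [Nat.cast_nonneg (α := ℝ) n]
      · linarith
    have h3 := hexp m hm0 le_rfl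
    calc _ ≤ (3 / 2) * 2 * ((n + 1 : ℕ) : ℝ) ^ (-(3 / 2) : ℝ) := by gcongr
      _ ≤ _ := by gcongr; norm_num
  have hsumm : Summable (fun n : ℕ => 5 * ((n + 1 : ℕ) : ℝ) ^ (-(3 / 2) : ℝ)) :=
    ((summable_nat_add_iff 1).2 summ32).mul_left _
  have hb0 : ‖blk χ 0 s‖ ≤ 2 * (1 + Real.log m) := by
    have e1 : ‖blk χ 0 s‖ ≤ ∑ a ∈ Finset.range m, 2 * ((a : ℝ))⁻¹ := by
      rw [blk]
      refine (norm_sum_le _ _).trans ?_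
      have e2 : ∑ a ∈ Finset.range m, 2 * ((a : ℝ))⁻¹ = ∑ a : ZMod m, 2 * (a.val : ℝ)⁻¹ := by
        symm
        refine Finset.sum_nbij (fun a => a.val) ?_ ?_ ?_ ?_
        · intro a _; simpa using ZMod.val_lt a
        · intro a _ b _ h; exact ZMod.val_injective m h
        · intro a ha
          refine ⟨(a : ZMod m), by simp, ?_⟩
          exact ZMod.val_natCast_of_lt (by simpa using ha)
        · intro a _; rfl
      rw [e2]
      refine Finset.sum_le_sum fun a _ => ?_
      by_cases ha : a = 0
      · subst ha; rw [MulChar.map_zero]; simp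
      · have hav : 1 ≤ a.val := by
          have : a.val ≠ 0 := by simpa using ha
          omega
        have hav' : (1 : ℝ) ≤ a.val := by exact_mod_cast hav
        rw [norm_mul]
        have e3 : ‖((a.val + m * 0 : ℕ) : ℂ) ^ (-s)‖ = (a.val : ℝ)⁻¹ * (a.val : ℝ) ^ (1 - s.re) := by
          rw [mul_zero, add_zero, Complex.norm_natCast_cpow_of_pos (by omega), neg_re,
            ← Real.rpow_neg_one, ← Real.rpow_add (by linarith)]
          congr 1; ring
        rw [e3]
        have e4 := hexp a.val hav' (by exact_mod_cast (ZMod.val_lt a).le)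
        calc _ ≤ 1 * ((a.val : ℝ)⁻¹ * 2) := by
              gcongr
              exact χ.norm_le_one a
          _ = _ := by ring
    refine e1.trans ?_
    rw [← Finset.mul_sum]
    gcongr
    have e5 := harmonic_le_one_add_log (m - 1)
    rw [harmonic] at e5
    push_cast at e5
    have e6 : ∑ a ∈ Finset.range m, ((a : ℝ))⁻¹ = ∑ i ∈ Finset.range (m - 1), ((i : ℝ) + 1)⁻¹ := by
      conv_lhs => rw [show m = (m - 1) + 1 by omega, Finset.sum_range_succ']
      simp
    rw [e6]
    refine e5.trans ?_
    gcongr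
    · have : (0 : ℝ) < ((m - 1 : ℕ) : ℝ) := by exact_mod_cast (by omega : 0 < m - 1)
      exact this
    · omega
  rw [LFunction_eq_tsum_blk hm hχ hball, Summable.tsum_eq_zero_add]
  · refine (norm_add_le _ _).trans ?_
    have e7 := tsum_of_norm_bounded hsumm.hasSum hb1
    have e8 : ∑' n : ℕ, 5 * ((n + 1 : ℕ) : ℝ) ^ (-(3 / 2) : ℝ) ≤ 5 * c32 := by
      rw [tsum_mul_left]
      gcongr
      rw [c32, summ32.tsum_eq_zero_add]
      simp
    have : C0 * (1 + Real.log m) ≥ 2 * (1 + Real.log m) + 5 * c32 := by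
      unfold C0; nlinarith [c32_nonneg, mul_nonneg c32_nonneg hlog]
    linarith
  · rw [← summable_nat_add_iff 1]
    exact Summable.of_norm_bounded hsumm hb1

end Carm

namespace Carm
open Complex

lemma V_ge {m : ℕ} [NeZero m] {V : ℝ} (hV : C0 * (1 + Real.log m) ≤ V) : 200 ≤ V := by
  have hm0 : (1 : ℝ) ≤ m := by exact_mod_cast NeZero.pos m
  have hlog : 0 ≤ Real.log m := Real.log_nonneg hm0
  nlinarith [C0_ge]

lemma LFunction_deriv_bound {m : ℕ} [NeZero m] {χ : DirichletCharacter ℂ m} (hχ : χ ≠ 1) {V : ℝ}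
    (hV : C0 * (1 + Real.log m) ≤ V) {s : ℂ} (hs : ‖s - 1‖ ≤ 1 / V) :
    ‖deriv χ.LFunction s‖ ≤ V ^ 2 := by
  have hV2 := V_ge hV
  have := Complex.norm_deriv_le_of_forall_mem_sphere_norm_le (c := s) (R := 1 / V) (C := V)
    (f := χ.LFunction) (by positivity)
    (DirichletCharacter.differentiable_LFunction hχ).diffContOnCl ?_
  · refine this.trans (le_of_eq ?_)
    field_simp
  · intro z hz
    refine LFunction_bound hχ hV ?_
    rw [mem_sphere_iff_norm] at hz
    calc ‖z - 1‖ = ‖(z - s) + (s - 1)‖ := by ring_nf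
      _ ≤ _ := norm_add_le _ _
      _ ≤ 1 / V + 1 / V := by rw [hz]; linarith
      _ = 2 / V := by ring

lemma LFunction_lip {m : ℕ} [NeZero m] {χ : DirichletCharacter ℂ m} (hχ : χ ≠ 1) {V : ℝ}
    (hV : C0 * (1 + Real.log m) ≤ V) {s : ℂ} (hs : ‖s - 1‖ ≤ 1 / V) :
    ‖χ.LFunction s - χ.LFunction 1‖ ≤ V ^ 2 * ‖s - 1‖ := by
  have hV2 := V_ge hV
  refine Convex.norm_image_sub_le_of_norm_deriv_le (s := Metric.closedBall (1 : ℂ) (1 / V))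
    (fun z _ => (DirichletCharacter.differentiable_LFunction hχ) z) ?_ (convex_closedBall _ _) ?_ ?_
  · intro z hz
    exact LFunction_deriv_bound hχ hV (mem_closedBall_iff_norm.1 hz)
  · exact Metric.mem_closedBall_self (by positivity)
  · exact mem_closedBall_iff_norm.2 hs

lemma tsum_rpow_le {x : ℝ} (hx : 0 < x) :
    ∑' n : ℕ, 1 / ((n : ℝ) + 1) ^ (1 + x) ≤ 1 + 1 / x := by
  have h := ZetaAsymptotics.zeta_limit_aux1 (s := 1 + x) (by linarith)
  have h2 : 0 ≤ ZetaAsymptotics.termTSum (1 + x) :=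
    tsum_nonneg fun n => ZetaAsymptotics.term_nonneg _ _
  have h3 : 0 ≤ (1 + x) * ZetaAsymptotics.termTSum (1 + x) := by positivity
  rw [add_sub_cancel_left] at h
  linarith

lemma summable_rpow_shift {x : ℝ} (hx : 0 < x) :
    Summable fun n : ℕ => 1 / ((n : ℝ) + 1) ^ (1 + x) := by
  have := (summable_nat_add_iff 1).2 (Real.summable_one_div_nat_rpow.2 (by linarith : 1 < 1 + x))
  simpa using this

lemma LSeries_norm_le {f : ℕ → ℂ} (hf : ∀ n, ‖f n‖ ≤ 1) {x : ℝ} (hx : 0 < x) (hx1 : x ≤ 1) :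
    ‖LSeries f (1 + x)‖ ≤ 2 / x := by
  have hb : ∀ n : ℕ, ‖LSeries.term f (1 + x) (n + 1)‖ ≤ 1 / ((n : ℝ) + 1) ^ (1 + x) := by
    intro n
    rw [LSeries.norm_term_eq]
    simp only [Nat.add_eq_zero_iff, one_ne_zero, and_false, if_false]
    simp
    have := hf (n + 1)
    rw [div_eq_mul_inv]
    have h2 : (0 : ℝ) ≤ (((n : ℝ) + 1) ^ (1 + x))⁻¹ := by positivity
    nlinarith
  have hs := summable_rpow_shift hx
  rw [LSeries, Summable.tsum_eq_zero_add ((summable_nat_add_iff 1).1 (hs.of_norm_bounded hb))]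
  rw [LSeries.term_zero, zero_add]
  refine (tsum_of_norm_bounded hs.hasSum hb).trans ((tsum_rpow_le hx).trans ?_)
  rw [le_div_iff₀ hx, add_mul, one_div_mul_cancel hx.ne']
  linarith

/-- All nontrivial characters mod m have L(1) not too small. -/
def Good (V : ℝ) (m : ℕ) [NeZero m] : Prop :=
  ∀ χ : DirichletCharacter ℂ m, χ ≠ 1 → 1 / V ^ 8 ≤ ‖χ.LFunction 1‖

lemma near_one {V : ℝ} (hV : 200 ≤ V) : ‖(1 + ((1 / V ^ 10 : ℝ) : ℂ)) - 1‖ = 1 / V ^ 10 ∧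
    1 / V ^ 10 ≤ 1 / V ∧ (0 : ℝ) < 1 / V ^ 10 ∧ 1 / V ^ 10 ≤ 1 := by
  refine ⟨?_, ?_, by positivity, ?_⟩
  · rw [add_sub_cancel_left, norm_real, Real.norm_eq_abs, abs_of_pos (by positivity)]
  · apply one_div_le_one_div_of_le (by linarith)
    exact le_self_pow₀ (by linarith) (by norm_num)
  · rw [div_le_one (by positivity)]
    exact one_le_pow₀ (by linarith)

lemma small_near {m : ℕ} [NeZero m] {χ : DirichletCharacter ℂ m} (hχ : χ ≠ 1) {V : ℝ}
    (hV : C0 * (1 + Real.log m) ≤ V) (hb : ‖χ.LFunction 1‖ < 1 / V ^ 8) :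
    ‖LSeries (fun n => χ n) (1 + ((1 / V ^ 10 : ℝ) : ℂ))‖ ≤ 2 / V ^ 8 := by
  have hV2 := V_ge hV
  obtain ⟨h1, h2, h3, h4⟩ := near_one hV2
  have hl := LFunction_lip hχ hV (s := 1 + ((1 / V ^ 10 : ℝ) : ℂ)) (by rw [h1]; exact h2)
  rw [h1] at hl
  rw [← DirichletCharacter.LFunction_eq_LSeries χ (by rw [add_re, one_re, ofReal_re]; linarith)]
  have e : V ^ 2 * (1 / V ^ 10) = 1 / V ^ 8 := by field_simp
  rw [e] at hl
  have := norm_sub_norm_le (χ.LFunction (1 + ((1 / V ^ 10 : ℝ) : ℂ))) (χ.LFunction 1)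
  have e2 : 2 / V ^ 8 = 1 / V ^ 8 + 1 / V ^ 8 := by ring
  linarith

lemma LSeries_bound {m : ℕ} [NeZero m] {χ : DirichletCharacter ℂ m} (hχ : χ ≠ 1) {V : ℝ}
    (hV : C0 * (1 + Real.log m) ≤ V) :
    ‖LSeries (fun n => χ n) (1 + ((1 / V ^ 10 : ℝ) : ℂ))‖ ≤ V := by
  have hV2 := V_ge hV
  obtain ⟨h1, h2, h3, h4⟩ := near_one hV2
  rw [← DirichletCharacter.LFunction_eq_LSeries χ (by rw [add_re, one_re, ofReal_re]; linarith)]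
  refine LFunction_bound hχ hV ?_
  rw [h1]
  refine h2.trans ?_
  gcongr; norm_num

lemma good_complex {m : ℕ} [NeZero m] {χ : DirichletCharacter ℂ m} (hχ : χ ^ 2 ≠ 1) {V : ℝ}
    (hV : C0 * (1 + Real.log m) ≤ V) : 1 / V ^ 8 ≤ ‖χ.LFunction 1‖ := by
  by_contra hcon
  push Not at hcon
  have hχ1 : χ ≠ 1 := by rintro rfl; simp at hχ
  have hV2 := V_ge hV
  obtain ⟨h1, h2, h3, h4⟩ := near_one hV2
  have ha := small_near hχ1 hV hcon
  have hb := LSeries_bound hχ hV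
  have hc := LSeries_norm_le (f := fun n => (1 : DirichletCharacter ℂ m) n)
    (fun n => DirichletCharacter.norm_le_one _ _) h3 h4
  have hp := χ.norm_LSeries_product_ge_one h3 0
  simp only [ofReal_zero, mul_zero, add_zero, norm_mul, norm_pow] at hp
  have : (1 : ℝ) ≤ (2 / (1 / V ^ 10)) ^ 3 * (2 / V ^ 8) ^ 4 * V := by
    refine le_trans hp ?_
    gcongr
  have e : (2 / (1 / V ^ 10)) ^ 3 * (2 / V ^ 8) ^ 4 * V = 128 / V := by field_simp; norm_num
  rw [e, le_div_iff₀ (by linarith)] at this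
  linarith

lemma sq_eq_one_iff_side {z : ℂ} (h : z ^ 2 = 1) : z = 1 ∨ z = -1 := by
  have : (z - 1) * (z + 1) = 0 := by linear_combination h
  rcases mul_eq_zero.1 this with h | h
  · left; linear_combination h
  · right; linear_combination h

lemma real_vals {m : ℕ} [NeZero m] {χ : DirichletCharacter ℂ m} (hχ : χ ^ 2 = 1) (a : ZMod m) :
    χ a = 0 ∨ χ a = 1 ∨ χ a = -1 := by
  by_cases ha : IsUnit a
  · right
    have : (χ a) ^ 2 = 1 := by
      rw [← MulChar.pow_apply' χ (by norm_num), hχ, MulChar.one_apply ha]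
    exact sq_eq_one_iff_side this
  · left; exact MulChar.map_nonunit χ ha

lemma local_ge {u : ℝ} (hu0 : 0 ≤ u) (hu1 : u < 1) {a b : ℂ} (ha : a = 0 ∨ a = 1 ∨ a = -1)
    (hb : b = 0 ∨ b = 1 ∨ b = -1) :
    1 ≤ ‖(1 - 1 * (u : ℂ))⁻¹ * (1 - a * (u : ℂ))⁻¹ * ((1 - b * (u : ℂ))⁻¹ *
      (1 - a * b * (u : ℂ))⁻¹)‖ := by
  have hu2 : u ^ 2 ≤ 1 := by nlinarith
  have key : ∃ r : ℝ, 0 < r ∧ r ≤ 1 ∧ (1 - 1 * (u : ℂ)) * (1 - a * (u : ℂ)) * ((1 - b * (u : ℂ)) *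
      (1 - a * b * (u : ℂ))) = (r : ℂ) := by
    have h1 : 0 < 1 - u := by linarith
    have h2 : 0 < 1 + u := by linarith
    have q1 : (1 - u) * (1 - u) ≤ 1 := by nlinarith
    have q2 : (1 - u) * (1 + u) ≤ 1 := by nlinarith
    have p1 : 0 < (1 - u) * (1 - u) := by positivity
    have p2 : 0 < (1 - u) * (1 + u) := by positivity
    rcases ha with rfl | rfl | rfl <;> rcases hb with rfl | rfl | rfl
    · exact ⟨1 - u, h1, by linarith, by push_cast; ring⟩
    · exact ⟨(1 - u) * (1 - u), p1, q1, by push_cast; ring⟩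
    · exact ⟨(1 - u) * (1 + u), p2, q2, by push_cast; ring⟩
    · exact ⟨(1 - u) * (1 - u), p1, q1, by push_cast; ring⟩
    · exact ⟨((1 - u) * (1 - u)) * ((1 - u) * (1 - u)), by positivity, by nlinarith,
        by push_cast; ring⟩
    · exact ⟨((1 - u) * (1 + u)) * ((1 - u) * (1 + u)), by positivity, by nlinarith,
        by push_cast; ring⟩
    · exact ⟨(1 - u) * (1 + u), p2, q2, by push_cast; ring⟩
    · exact ⟨((1 - u) * (1 + u)) * ((1 - u) * (1 + u)), by positivity, by nlinarith,
        by push_cast; ring⟩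
    · exact ⟨((1 - u) * (1 + u)) * ((1 - u) * (1 + u)), by positivity, by nlinarith,
        by push_cast; ring⟩
  obtain ⟨r, hr0, hr1, hr⟩ := key
  rw [← mul_inv, ← mul_inv, ← mul_inv, hr, norm_inv, norm_real, Real.norm_eq_abs, abs_of_pos hr0]
  exact (one_le_inv₀ hr0).2 hr1

lemma pair_prod {m₁ m₂ N : ℕ} [NeZero m₁] [NeZero m₂] {χ₁ : DirichletCharacter ℂ m₁}
    {χ₂ : DirichletCharacter ℂ m₂} {χ₃ : DirichletCharacter ℂ N} (h1 : χ₁ ^ 2 = 1) (h2 : χ₂ ^ 2 = 1)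
    (h3 : ∀ n : ℕ, χ₃ n = χ₁ n * χ₂ n) {x : ℝ} (hx : 0 < x) :
    1 ≤ ‖LSeries (fun n => (1 : DirichletCharacter ℂ 1) n) (1 + x) *
      LSeries (fun n => χ₁ n) (1 + x) *
      (LSeries (fun n => χ₂ n) (1 + x) * LSeries (fun n => χ₃ n) (1 + x))‖ := by
  have hs : 1 < (1 + (x : ℂ)).re := by simpa using hx
  have hp := (((1 : DirichletCharacter ℂ 1).LSeries_eulerProduct_hasProd hs).mul
    (χ₁.LSeries_eulerProduct_hasProd hs)).mul ((χ₂.LSeries_eulerProduct_hasProd hs).mul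
    (χ₃.LSeries_eulerProduct_hasProd hs))
  have hp2 := hp.norm
  refine ge_of_tendsto' hp2 fun S => ?_
  refine Finset.prod_induction _ (fun r : ℝ => 1 ≤ r) (fun a b ha hb => one_le_mul_of_one_le_of_one_le ha hb) le_rfl fun p _ => ?_
  have hpp : 1 < (p : ℕ) := p.2.one_lt
  have e : ((p : ℕ) : ℂ) ^ (-(1 + (x : ℂ))) = (((p : ℕ) : ℝ) ^ (-(1 + x)) : ℝ) := by
    rw [ofReal_cpow (by positivity)]
    push_cast; rfl
  rw [e, h3]
  have : ((1 : DirichletCharacter ℂ 1) ((p : ℕ) : ZMod 1)) = 1 :=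
    MulChar.one_apply (isUnit_of_subsingleton _)
  rw [this]
  refine local_ge (by positivity) ?_ (real_vals h1 _) (real_vals h2 _)
  exact Real.rpow_lt_one_of_one_lt_of_neg (by exact_mod_cast hpp) (by linarith)

lemma lift_prod {m₁ m₂ : ℕ} [NeZero m₁] [NeZero m₂] (hc : Nat.Coprime m₁ m₂)
    {χ₁ : DirichletCharacter ℂ m₁} (χ₂ : DirichletCharacter ℂ m₂) (h1 : χ₁ ≠ 1) :
    ∃ χ₃ : DirichletCharacter ℂ (m₁ * m₂), χ₃ ≠ 1 ∧ ∀ n : ℕ, χ₃ n = χ₁ n * χ₂ n := by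
  set χ₃ := DirichletCharacter.changeLevel (dvd_mul_right m₁ m₂) χ₁ *
    DirichletCharacter.changeLevel (dvd_mul_left m₂ m₁) χ₂ with h3
  have hv : ∀ n : ℕ, χ₃ n = χ₁ n * χ₂ n := by
    intro n
    by_cases hn : n.Coprime (m₁ * m₂)
    · have hu : IsUnit ((n : ℕ) : ZMod (m₁ * m₂)) := (ZMod.isUnit_iff_coprime _ _).2 hn
      have c1 := DirichletCharacter.changeLevel_eq_cast_of_dvd χ₁ (dvd_mul_right m₁ m₂) hu.unit
      have c2 := DirichletCharacter.changeLevel_eq_cast_of_dvd χ₂ (dvd_mul_left m₂ m₁) hu.unit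
      rw [IsUnit.unit_spec] at c1 c2
      rw [h3, MulChar.mul_apply, c1, c2]
      simp [ZMod.cast_natCast (dvd_mul_right m₁ m₂), ZMod.cast_natCast (dvd_mul_left m₂ m₁)]
    · rw [MulChar.map_nonunit χ₃ (by rwa [ZMod.isUnit_iff_coprime])]
      rw [Nat.coprime_mul_iff_right, not_and_or] at hn
      rcases hn with hn | hn
      · rw [MulChar.map_nonunit χ₁ (by rwa [ZMod.isUnit_iff_coprime]), zero_mul]
      · rw [MulChar.map_nonunit χ₂ (by rwa [ZMod.isUnit_iff_coprime]), mul_zero]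
  refine ⟨χ₃, ?_, hv⟩
  intro h
  apply h1
  ext a
  obtain ⟨x, hx1, hx2⟩ := Nat.chineseRemainder hc (a : ZMod m₁).val 1
  have e1 : ((x : ℕ) : ZMod m₁) = a := by
    have := (ZMod.natCast_eq_natCast_iff _ _ _).2 hx1
    rw [this, ZMod.natCast_zmod_val]
  have e2 : ((x : ℕ) : ZMod m₂) = 1 := by
    have := (ZMod.natCast_eq_natCast_iff _ _ _).2 hx2
    rw [this, Nat.cast_one]
  have hx := hv x
  rw [e1, e2, map_one, mul_one, h] at hx
  rw [← hx, MulChar.one_apply_coe, MulChar.one_apply]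
  rw [ZMod.isUnit_iff_coprime, Nat.coprime_mul_iff_right]
  constructor
  · rw [← ZMod.isUnit_iff_coprime, e1]; exact a.isUnit
  · rw [← ZMod.isUnit_iff_coprime, e2]; exact isUnit_one

lemma good_pair {m₁ m₂ : ℕ} [NeZero m₁] [NeZero m₂] (hc : Nat.Coprime m₁ m₂) {V : ℝ}
    (hV1 : C0 * (1 + Real.log m₁) ≤ V) (hV2 : C0 * (1 + Real.log m₂) ≤ V)
    (hV : C0 * (1 + Real.log (m₁ * m₂ : ℕ)) ≤ V) : Good V m₁ ∨ Good V m₂ := by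
  by_contra hcon
  rw [not_or, Good, Good] at hcon
  push Not at hcon
  obtain ⟨⟨χ₁, h1, hb1⟩, ⟨χ₂, h2, hb2⟩⟩ := hcon
  have hV0 := V_ge hV1
  have r1 : χ₁ ^ 2 = 1 := by
    by_contra h; exact absurd (good_complex h hV1) (not_le.2 hb1)
  have r2 : χ₂ ^ 2 = 1 := by
    by_contra h; exact absurd (good_complex h hV2) (not_le.2 hb2)
  obtain ⟨χ₃, h3, hv⟩ := lift_prod hc χ₂ h1
  obtain ⟨-, -, p3, p4⟩ := near_one hV0
  have hp := pair_prod r1 r2 hv p3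
  have a1 := small_near h1 hV1 hb1
  have a2 := small_near h2 hV2 hb2
  have a3 := LSeries_bound h3 hV
  have a4 := LSeries_norm_le (f := fun n => (1 : DirichletCharacter ℂ 1) n)
    (fun n => DirichletCharacter.norm_le_one _ _) p3 p4
  rw [norm_mul, norm_mul, norm_mul] at hp
  have : (1 : ℝ) ≤ (2 / (1 / V ^ 10)) * (2 / V ^ 8) * ((2 / V ^ 8) * V) := by
    refine le_trans hp ?_
    gcongr
  have e : (2 / (1 / V ^ 10)) * (2 / V ^ 8) * ((2 / V ^ 8) * V) = 8 / V ^ 5 := by field_simp; norm_num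
  rw [e, le_div_iff₀ (by positivity)] at this
  have : V ≤ V ^ 5 := le_self_pow₀ (by linarith) (by norm_num)
  linarith

end Carm

namespace Carm
open Complex
open ArithmeticFunction (vonMangoldt)

lemma logMul_iter (f : ℕ → ℂ) (j n : ℕ) :
    (LSeries.logMul^[j] f) n = (Complex.log n) ^ j * f n := by
  induction j with
  | zero => simp
  | succ j ih => rw [Function.iterate_succ_apply', LSeries.logMul, ih]; ring

lemma abscissa_le {f : ℕ → ℝ} (h0 : ∀ n, 0 ≤ f n) (h1 : ∀ n, f n ≤ vonMangoldt n) :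
    LSeries.abscissaOfAbsConv (fun n => (f n : ℂ)) ≤ 1 := by
  refine LSeries.abscissaOfAbsConv_le_of_forall_lt_LSeriesSummable fun y hy => ?_
  have := ArithmeticFunction.LSeriesSummable_vonMangoldt (s := y) (by simpa using hy)
  refine Summable.of_norm_bounded this.norm fun n => ?_
  refine LSeries.norm_term_le _ ?_
  rw [norm_real, norm_real, Real.norm_of_nonneg (h0 n), Real.norm_of_nonneg ((h0 n).trans (h1 n))]
  exact h1 n

lemma abscissa_lt {f : ℕ → ℝ} (h0 : ∀ n, 0 ≤ f n) (h1 : ∀ n, f n ≤ vonMangoldt n) {s : ℂ}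
    (hs : 1 < s.re) : LSeries.abscissaOfAbsConv (fun n => (f n : ℂ)) < s.re :=
  (abscissa_le h0 h1).trans_lt (by exact_mod_cast hs)

/-- the weight -/
noncomputable def wt (δ : ℝ) (j : ℕ) (n : ℕ) : ℝ := (Real.log n) ^ j / (n : ℝ) ^ (1 + δ)

lemma wt_nonneg (δ : ℝ) (j n : ℕ) : 0 ≤ wt δ j n := by
  unfold wt
  have : 0 ≤ Real.log n := Real.log_natCast_nonneg n
  positivity

lemma term_real (f : ℕ → ℝ) (hf : f 0 = 0) (δ : ℝ) (j n : ℕ) :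
    LSeries.term (LSeries.logMul^[j] (fun n => (f n : ℂ))) (1 + δ) n =
      ((f n * wt δ j n : ℝ) : ℂ) := by
  rw [LSeries.term_def, logMul_iter]
  split_ifs with h
  · subst h; simp [hf]
  · unfold wt
    push_cast
    rw [ofReal_cpow (by positivity)]
    push_cast
    rw [← Complex.natCast_log]
    ring

lemma series_real {f : ℕ → ℝ} (h0 : ∀ n, 0 ≤ f n) (h1 : ∀ n, f n ≤ vonMangoldt n) {δ : ℝ}
    (hδ : 0 < δ) (j : ℕ) : Summable (fun n => f n * wt δ j n) ∧
    (-1) ^ j * iteratedDeriv j (LSeries (fun n => (f n : ℂ))) (1 + δ) =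
      ((∑' n, f n * wt δ j n : ℝ) : ℂ) := by
  have hf0 : f 0 = 0 := le_antisymm (by simpa using h1 0) (h0 0)
  have hs : 1 < (1 + (δ : ℂ)).re := by simpa using hδ
  have ha := abscissa_lt h0 h1 hs
  constructor
  · have hsum : LSeriesSummable (LSeries.logMul^[j] (fun n => (f n : ℂ))) (1 + δ) :=
      LSeriesSummable_of_abscissaOfAbsConv_lt_re (by rwa [LSeries.absicssaOfAbsConv_logPowMul])
    rw [LSeriesSummable] at hsum
    simp_rw [funext (term_real f hf0 δ j)] at hsum
    exact_mod_cast hsum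
  · rw [LSeries_iteratedDeriv j ha, ← mul_assoc, ← mul_pow, neg_one_mul, neg_neg, one_pow, one_mul,
      LSeries, ofReal_tsum]
    exact tsum_congr fun n => term_real f hf0 δ j n

/-- nontrivial characters: bound for derivatives of the logarithmic derivative -/
lemma nontriv_bound {m : ℕ} [NeZero m] {χ : DirichletCharacter ℂ m} (hχ : χ ≠ 1) {V : ℝ}
    (hV : C0 * (1 + Real.log m) ≤ V) (hg : 1 / V ^ 8 ≤ ‖χ.LFunction 1‖) (j : ℕ) :
    ‖iteratedDeriv j (fun s => deriv χ.LFunction s / χ.LFunction s)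
      (1 + ((1 / (16 * V ^ 10) : ℝ) : ℂ))‖ ≤ j.factorial * (4 * V ^ 10) ^ (j + 1) := by
  have hV2 := V_ge hV
  have hV10 : V ≤ V ^ 10 := le_self_pow₀ (by linarith) (by norm_num)
  have hR : ∀ z : ℂ, ‖z - 1‖ ≤ 1 / (2 * V ^ 10) → 1 / (2 * V ^ 8) ≤ ‖χ.LFunction z‖ ∧
      ‖deriv χ.LFunction z / χ.LFunction z‖ ≤ 2 * V ^ 10 := by
    intro z hz
    have hz' : ‖z - 1‖ ≤ 1 / V := hz.trans (one_div_le_one_div_of_le (by linarith) (by linarith))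
    have h1 := LFunction_lip hχ hV hz'
    have h2 : V ^ 2 * ‖z - 1‖ ≤ 1 / (2 * V ^ 8) := by
      calc _ ≤ V ^ 2 * (1 / (2 * V ^ 10)) := by gcongr
        _ = _ := by field_simp
    have h3 := norm_sub_norm_le (χ.LFunction 1) (χ.LFunction z)
    rw [norm_sub_rev] at h3
    have e : 1 / V ^ 8 = 1 / (2 * V ^ 8) + 1 / (2 * V ^ 8) := by field_simp; norm_num
    have h4 : 1 / (2 * V ^ 8) ≤ ‖χ.LFunction z‖ := by linarith
    refine ⟨h4, ?_⟩
    have h5 := LFunction_deriv_bound hχ hV hz'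
    rw [norm_div]
    calc _ ≤ V ^ 2 / (1 / (2 * V ^ 8)) := by gcongr
      _ = _ := by field_simp
  have hd : Differentiable ℂ χ.LFunction := DirichletCharacter.differentiable_LFunction hχ
  have hd' : Differentiable ℂ (deriv χ.LFunction) := by
    have := hd.contDiff (n := 2)
    exact (this.differentiable_deriv_two)
  have hin : ∀ z : ℂ, z ∈ Metric.closedBall (1 + ((1 / (16 * V ^ 10) : ℝ) : ℂ)) (1 / (4 * V ^ 10)) →
      ‖z - 1‖ ≤ 1 / (2 * V ^ 10) := by
    intro z hz
    rw [mem_closedBall_iff_norm] at hz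
    have h1 : ‖((1 / (16 * V ^ 10) : ℝ) : ℂ)‖ = 1 / (16 * V ^ 10) := by
      rw [norm_real, Real.norm_of_nonneg (by positivity)]
    have h2 := norm_add_le (z - (1 + ((1 / (16 * V ^ 10) : ℝ) : ℂ))) ((1 / (16 * V ^ 10) : ℝ) : ℂ)
    rw [h1] at h2
    have e : z - (1 + ((1 / (16 * V ^ 10) : ℝ) : ℂ)) + ((1 / (16 * V ^ 10) : ℝ) : ℂ) = z - 1 := by ring
    rw [e] at h2
    have e1 : 1 / (16 * V ^ 10) = (1 / 16) * (1 / V ^ 10) := by field_simp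
    have e2 : 1 / (4 * V ^ 10) = (1 / 4) * (1 / V ^ 10) := by field_simp
    have e3 : 1 / (2 * V ^ 10) = (1 / 2) * (1 / V ^ 10) := by field_simp
    have e4 : 0 < 1 / V ^ 10 := by positivity
    rw [e2] at hz; rw [e3]
    linarith [e1]
  have := norm_iteratedDeriv_le_of_forall_mem_sphere_norm_le j
    (c := 1 + ((1 / (16 * V ^ 10) : ℝ) : ℂ)) (R := 1 / (4 * V ^ 10)) (C := 2 * V ^ 10)
    (f := fun s => deriv χ.LFunction s / χ.LFunction s) (by positivity) ?_ ?_
  · refine this.trans ?_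
    rw [one_div, inv_pow, div_inv_eq_mul, mul_assoc, pow_succ (4 * V ^ 10) j, mul_comm ((4 * V ^ 10) ^ j)]
    gcongr
    norm_num
  · refine DifferentiableOn.diffContOnCl_ball (U := Metric.closedBall (1 + ((1 / (16 * V ^ 10) : ℝ) : ℂ)) (1 / (4 * V ^ 10))) ?_ le_rfl
    intro z hz
    refine ((hd' z).div (hd z) ?_).differentiableWithinAt
    have := (hR z (hin z hz)).1
    intro h
    rw [h, norm_zero] at this
    have : 0 < 1 / (2 * V ^ 8) := by positivity
    linarith
  · intro z hz
    exact (hR z (hin z (Metric.sphere_subset_closedBall hz))).2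

/-- zeta -/
lemma zeta_bound : ∃ B : ℝ, 1 ≤ B ∧ ∀ δ : ℝ, 0 < δ → δ ≤ 1 / B → ∀ j : ℕ,
    |∑' n, vonMangoldt n * wt δ j n - j.factorial / δ ^ (j + 1)| ≤ j.factorial * B ^ (j + 1) := by
  set Z := DirichletCharacter.LFunctionTrivChar₁ 1 with hZ
  have hd : Differentiable ℂ Z := DirichletCharacter.differentiable_LFunctionTrivChar₁ 1
  have hd' : Differentiable ℂ (deriv Z) := by
    have := hd.contDiff (n := 2)
    exact (this.differentiable_deriv_two)
  have hZ1 : Z 1 ≠ 0 := DirichletCharacter.LFunctionTrivChar₁_apply_one_ne_zero 1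
  have hc : ContinuousAt (fun s => deriv Z s / Z s) 1 :=
    ((hd' 1).div (hd 1) hZ1).continuousAt
  obtain ⟨r, hr, hball⟩ : ∃ r > 0, ∀ z : ℂ, ‖z - 1‖ < r →
      Z z ≠ 0 ∧ ‖deriv Z z / Z z‖ < ‖deriv Z 1 / Z 1‖ + 1 := by
    have h1 := (hd 1).continuousAt.eventually_ne hZ1
    have h2 := hc.norm.eventually_lt_const (lt_add_one _)
    obtain ⟨r, hr, h⟩ := Metric.eventually_nhds_iff.1 (h1.and h2)
    exact ⟨r, hr, fun z hz => h (by rwa [dist_eq_norm])⟩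
  set B₀ := ‖deriv Z 1 / Z 1‖ + 1 with hB₀
  have hB₀1 : 1 ≤ B₀ := by have := norm_nonneg (deriv Z 1 / Z 1); linarith
  refine ⟨max B₀ (4 / r), le_max_of_le_left hB₀1, fun δ hδ hδB j => ?_⟩
  set B := max B₀ (4 / r) with hB
  have hB1 : 1 ≤ B := le_max_of_le_left hB₀1
  have hBr : 1 / B ≤ r / 4 := by
    rw [div_le_div_iff₀ (by linarith) (by norm_num)]
    have : 4 / r ≤ B := le_max_right _ _
    rw [div_le_iff₀ hr] at this
    linarith
  set s₀ : ℂ := 1 + (δ : ℂ) with hs₀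
  have hs1 : 1 < s₀.re := by simp [hs₀, hδ]
  -- the identity near s₀
  have hid : LSeries (fun n => (vonMangoldt n : ℂ)) =ᶠ[nhds s₀]
      fun s => (s - 1)⁻¹ - deriv Z s / Z s := by
    have : {w : ℂ | 1 < w.re} ∈ nhds s₀ :=
      (isOpen_lt continuous_const continuous_re).mem_nhds hs1
    filter_upwards [this] with w hw
    have hw : 1 < w.re := hw
    have hw1 : w ≠ 1 := by rintro rfl; simp at hw
    have hζ := riemannZeta_ne_zero_of_one_lt_re hw
    rw [ArithmeticFunction.LSeries_vonMangoldt_eq_deriv_riemannZeta_div hw]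
    have e1 : DirichletCharacter.LFunctionTrivChar 1 = riemannZeta :=
      DirichletCharacter.LFunction_modOne_eq
    have e2 := DirichletCharacter.deriv_LFunctionTrivChar₁_apply_of_ne_one 1 hw1
    rw [e1] at e2
    have e3 : Z w = (w - 1) * riemannZeta w := by
      rw [hZ, DirichletCharacter.LFunctionTrivChar₁, Function.update_of_ne hw1, e1]
    rw [← hZ] at e2
    rw [e2, e3]
    have : w - 1 ≠ 0 := sub_ne_zero.2 hw1
    field_simp
    ring
  obtain ⟨-, hser⟩ := series_real (f := fun n => vonMangoldt n)
    (fun n => ArithmeticFunction.vonMangoldt_nonneg) (fun n => le_rfl) hδ j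
  have hin : ∀ z : ℂ, z ∈ Metric.closedBall s₀ (r / 2) → ‖z - 1‖ < r := by
    intro z hz
    rw [mem_closedBall_iff_norm] at hz
    have h1 : ‖(δ : ℂ)‖ = δ := by rw [norm_real, Real.norm_of_nonneg hδ.le]
    have h2 := norm_add_le (z - s₀) (δ : ℂ)
    rw [h1, hs₀] at h2
    have e : z - (1 + (δ : ℂ)) + δ = z - 1 := by ring
    rw [e] at h2
    linarith
  have hana : ContDiffAt ℂ j (fun s => deriv Z s / Z s) s₀ := by
    have : DifferentiableOn ℂ (fun s => deriv Z s / Z s) (Metric.ball s₀ (r / 2)) := by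
      intro z hz
      exact ((hd' z).div (hd z) (hball z (hin z (Metric.ball_subset_closedBall hz))).1).differentiableWithinAt
    exact (this.analyticAt (Metric.ball_mem_nhds _ (by positivity))).contDiffAt
  have hne : s₀ - 1 ≠ 0 := by rw [hs₀, add_sub_cancel_left]; exact_mod_cast hδ.ne'
  have hinv : ContDiffAt ℂ j (fun s : ℂ => (s - 1)⁻¹) s₀ :=
    (contDiffAt_id.sub contDiffAt_const).inv hne
  rw [hid.iteratedDeriv_eq, iteratedDeriv_fun_sub hinv hana] at hser
  have hder : iteratedDeriv j (fun s : ℂ => (s - 1)⁻¹) s₀ = (-1) ^ j * j.factorial * ((δ : ℂ) ^ (j + 1))⁻¹ := by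
    have := congrFun (iteratedDeriv_comp_sub_const j (fun s : ℂ => s⁻¹) 1) s₀
    rw [this, iteratedDeriv_eq_iterate, iter_deriv_inv']
    rw [hs₀, add_sub_cancel_left]
    beta_reduce
    rw [show (-1 - (j : ℤ)) = -((j + 1 : ℕ) : ℤ) by push_cast; ring, zpow_neg, zpow_natCast]
  have hb := norm_iteratedDeriv_le_of_forall_mem_sphere_norm_le j
    (c := s₀) (R := r / 2) (C := B₀) (f := fun s => deriv Z s / Z s) (by positivity) ?_ ?_
  · have e : ((∑' n, vonMangoldt n * wt δ j n - j.factorial / δ ^ (j + 1) : ℝ) : ℂ) =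
        -((-1) ^ j * iteratedDeriv j (fun s => deriv Z s / Z s) s₀) := by
      rw [ofReal_sub, ← hser, hder]
      push_cast
      have : ((-1 : ℂ)) ^ j * (-1) ^ j = 1 := by rw [← mul_pow]; simp
      rw [mul_sub]
      linear_combination (j.factorial * ((δ : ℂ) ^ (j + 1))⁻¹) * this
    rw [← Real.norm_eq_abs, ← norm_real, e, norm_neg, norm_mul, norm_pow, norm_neg, norm_one, one_pow,
      one_mul]
    refine hb.trans ?_
    have h2r : 2 / r ≤ B := by
      refine le_trans ?_ (le_max_right _ _)
      gcongr; norm_num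
    have : (r / 2) ^ j = ((2 / r) ^ j)⁻¹ := by rw [← inv_pow, inv_div]
    rw [this, div_inv_eq_mul, mul_assoc, pow_succ, mul_comm (B ^ j)]
    gcongr
    exact le_max_left _ _
  · refine DifferentiableOn.diffContOnCl_ball (U := Metric.closedBall s₀ (r / 2)) ?_ le_rfl
    intro z hz
    exact ((hd' z).div (hd z) (hball z (hin z hz)).1).differentiableWithinAt
  · intro z hz
    exact (hball z (hin z (Metric.sphere_subset_closedBall hz))).2.le

end Carm

namespace Carm
open Complex
open ArithmeticFunction (vonMangoldt)

/-- nonprime weights -/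
noncomputable def npw (n : ℕ) : ℝ := by
  classical exact if ∃ x y : ℕ, n = (x + 1) ^ 2 * (y + 1) ^ 3 then 1 / (n : ℝ) ^ (3 / 4 : ℝ) else 0

lemma npw_nonneg (n : ℕ) : 0 ≤ npw n := by
  unfold npw; split_ifs <;> positivity

lemma npw_summable : Summable npw := by
  classical
  have h1 : Summable (fun x : ℕ => 1 / ((x : ℝ) + 1) ^ (1 + 1/2 : ℝ)) := summable_rpow_shift (by norm_num)
  have h2 : Summable (fun x : ℕ => 1 / ((x : ℝ) + 1) ^ (1 + 5/4 : ℝ)) := summable_rpow_shift (by norm_num)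
  have h3 := h1.mul_of_nonneg h2 (fun x => by positivity) (fun x => by positivity)
  set S : Set ℕ := {n | ∃ x y : ℕ, n = (x + 1) ^ 2 * (y + 1) ^ 3} with hS
  have e : npw = S.indicator (fun n => 1 / (n : ℝ) ^ (3 / 4 : ℝ)) := by
    ext n
    unfold npw Set.indicator
    congr
  rw [e, ← summable_subtype_iff_indicator]
  choose X Y hXY using fun n : S => n.2
  have hinj : Function.Injective (fun n : S => (X n, Y n)) := by
    intro a b hab
    simp only [Prod.mk.injEq] at hab
    apply Subtype.ext
    rw [hXY a, hXY b, hab.1, hab.2]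
  refine (h3.comp_injective hinj).congr fun n => ?_
  simp only [Function.comp_apply]
  conv_rhs => rw [hXY n]
  push_cast
  rw [Real.mul_rpow (by positivity) (by positivity), ← Real.rpow_natCast, ← Real.rpow_natCast,
    ← Real.rpow_mul (by positivity), ← Real.rpow_mul (by positivity)]
  norm_num
  ring

lemma pow_log_le {x : ℝ} (hx : 1 ≤ x) (n : ℕ) {c : ℝ} (hc : 0 < c) :
    (Real.log x) ^ n ≤ n.factorial * c ^ n * x ^ (1 / c) := by
  have h := Real.pow_div_factorial_le_exp (Real.log x / c) (by have := Real.log_nonneg hx; positivity) n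
  rw [Real.rpow_def_of_pos (by linarith)]
  rw [div_le_iff₀ (by positivity), div_pow, div_le_iff₀ (by positivity)] at h
  rw [mul_one_div]
  linarith

lemma wt_le {δ : ℝ} (hδ : 0 < δ) (j n : ℕ) (hn : 1 ≤ n) :
    wt δ j n ≤ j.factorial * 4 ^ j / (n : ℝ) ^ (3 / 4 : ℝ) := by
  have hn' : (1 : ℝ) ≤ n := by exact_mod_cast hn
  unfold wt
  have := pow_log_le hn' j (c := 4) (by norm_num)
  rw [div_le_div_iff₀ (by positivity) (by positivity)]
  calc _ ≤ (j.factorial * 4 ^ j * (n : ℝ) ^ (1 / 4 : ℝ)) * (n : ℝ) ^ (3 / 4 : ℝ) := by gcongr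
    _ = j.factorial * 4 ^ j * ((n : ℝ) ^ (1 / 4 : ℝ) * (n : ℝ) ^ (3 / 4 : ℝ)) := by ring
    _ ≤ _ := by
      gcongr
      rw [← Real.rpow_add (by positivity)]
      exact Real.rpow_le_rpow_of_exponent_le hn' (by linarith)

lemma wt_succ (δ : ℝ) (j n : ℕ) : Real.log n * wt δ j n = wt δ (j + 1) n := by
  unfold wt; ring

lemma np_bound {δ : ℝ} (hδ : 0 < δ) (j n : ℕ) (hn : ¬ n.Prime) :
    vonMangoldt n * wt δ j n ≤ ((j + 1).factorial * 4 ^ (j + 1)) * npw n := by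
  by_cases h : vonMangoldt n = 0
  · rw [h, zero_mul]
    have := npw_nonneg n
    positivity
  have hpp : IsPrimePow n := ArithmeticFunction.vonMangoldt_ne_zero_iff.1 h
  have hn1 : 1 ≤ n := hpp.one_lt.le
  have hS : ∃ x y : ℕ, n = (x + 1) ^ 2 * (y + 1) ^ 3 := by
    obtain ⟨p, k, hp, hk, rfl⟩ := hpp
    have hp' := hp.nat_prime
    have hk2 : 2 ≤ k := by
      by_contra hlt
      have : k = 1 := by omega
      subst this
      simp [hp'] at hn
    have hp1 : ∀ a, p ^ a - 1 + 1 = p ^ a := fun a => Nat.sub_add_cancel (Nat.one_le_pow _ _ hp'.pos)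
    rcases Nat.even_or_odd k with ⟨a, ha⟩ | ⟨a, ha⟩
    · refine ⟨p ^ a - 1, 0, ?_⟩
      rw [hp1, ha]; ring
    · refine ⟨p ^ (a - 1) - 1, p - 1, ?_⟩
      rw [hp1, Nat.sub_add_cancel hp'.one_le, ha, ← pow_mul, ← pow_add]
      congr 1; omega
  have e : npw n = 1 / (n : ℝ) ^ (3 / 4 : ℝ) := by
    unfold npw; rw [if_pos hS]
  rw [e, mul_one_div]
  refine le_trans ?_ (wt_le hδ (j + 1) n hn1)
  rw [← wt_succ]
  exact mul_le_mul_of_nonneg_right ArithmeticFunction.vonMangoldt_le_log (wt_nonneg _ _ _)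

lemma wt_le_fact {δ : ℝ} (hδ : 0 < δ) (j n : ℕ) (hn : 1 ≤ n) : wt δ j n ≤ j.factorial := by
  have hn' : (1 : ℝ) ≤ n := by exact_mod_cast hn
  unfold wt
  have := pow_log_le hn' j (c := 1) (by norm_num)
  rw [div_le_iff₀ (by positivity)]
  simp only [one_pow, mul_one, div_one, Real.rpow_one] at this
  refine this.trans ?_
  gcongr
  exact Real.self_le_rpow_of_one_le hn' (by linarith)

lemma sum_log_primeFactors_le {m : ℕ} (hm : m ≠ 0) :
    ∑ p ∈ m.primeFactors, Real.log p ≤ Real.log m := by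
  rw [← Real.log_prod (fun p hp => by
    have := (Nat.prime_of_mem_primeFactors hp).pos
    positivity)]
  apply Real.log_le_log
  · exact Finset.prod_pos fun p hp => by
      have := (Nat.prime_of_mem_primeFactors hp).pos
      positivity
  · have := Nat.le_of_dvd (Nat.pos_of_ne_zero hm) (Nat.prod_primeFactors_dvd m)
    have h2 : ((∏ p ∈ m.primeFactors, p : ℕ) : ℝ) ≤ m := Nat.cast_le.2 this
    rwa [Nat.cast_prod] at h2

/-- the sum over primes in a progression -/
noncomputable def tf (δ : ℝ) (j m n : ℕ) : ℝ :=
  if n.Prime ∧ (n : ZMod m) = 1 then wt δ (j + 1) n else 0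

lemma tf_nonneg (δ : ℝ) (j m n : ℕ) : 0 ≤ tf δ j m n := by
  unfold tf; split_ifs
  · exact wt_nonneg _ _ _
  · exact le_rfl

/-- characters identity -/
lemma char_ineq {m : ℕ} [NeZero m] {V : ℝ} (hV : C0 * (1 + Real.log m) ≤ V) (hg : Good V m) (j : ℕ)
    {δ : ℝ} (hδ : δ = 1 / (16 * V ^ 10)) :
    |m.totient * ∑' n, ArithmeticFunction.vonMangoldt.residueClass (1 : ZMod m) n * wt δ j n
      - ∑' n, (if n.Coprime m then vonMangoldt n else 0) * wt δ j n| ≤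
      m.totient * (j.factorial * (4 * V ^ 10) ^ (j + 1)) := by
  have hV2 := V_ge hV
  have hδ0 : 0 < δ := by rw [hδ]; positivity
  set s₀ : ℂ := 1 + (δ : ℂ) with hs₀
  have hs1 : 1 < s₀.re := by simp [hs₀, hδ0]
  have hnhds : {w : ℂ | 1 < w.re} ∈ nhds s₀ :=
    (isOpen_lt continuous_const continuous_re).mem_nhds hs1
  obtain ⟨-, ha⟩ := series_real (f := ArithmeticFunction.vonMangoldt.residueClass (1 : ZMod m))
    (fun n => ArithmeticFunction.vonMangoldt.residueClass_nonneg _ n)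
    (fun n => ArithmeticFunction.vonMangoldt.residueClass_le _ n) hδ0 j
  obtain ⟨-, hb⟩ := series_real (f := fun n => if n.Coprime m then vonMangoldt n else 0)
    (fun n => by split_ifs; exacts [ArithmeticFunction.vonMangoldt_nonneg, le_rfl])
    (fun n => by split_ifs; exacts [le_rfl, ArithmeticFunction.vonMangoldt_nonneg]) hδ0 j
  rw [← hs₀] at ha hb
  set F : DirichletCharacter ℂ m → ℂ → ℂ := fun χ s => deriv χ.LFunction s / χ.LFunction s with hF
  have hida : LSeries (fun n => ((ArithmeticFunction.vonMangoldt.residueClass (1 : ZMod m) n : ℝ) : ℂ)) =ᶠ[nhds s₀]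
      fun s => (-((m.totient : ℂ)⁻¹)) * ∑ χ : DirichletCharacter ℂ m, F χ s := by
    filter_upwards [hnhds] with w hw
    rw [ArithmeticFunction.vonMangoldt.LSeries_residueClass_eq isUnit_one hw]
    simp [hF]
  have hidb : LSeries (fun n => ((if n.Coprime m then vonMangoldt n else 0 : ℝ) : ℂ)) =ᶠ[nhds s₀]
      fun s => - F 1 s := by
    filter_upwards [hnhds] with w hw
    have := DirichletCharacter.LSeries_twist_vonMangoldt_eq (1 : DirichletCharacter ℂ m) hw
    rw [hF]
    simp only
    rw [DirichletCharacter.deriv_LFunction_eq_deriv_LSeries _ hw, DirichletCharacter.LFunction_eq_LSeries _ hw,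
      ← neg_div, ← this]
    congr 1
    ext n
    simp only [Pi.mul_apply]
    split_ifs with h
    · rw [MulChar.one_apply ((ZMod.isUnit_iff_coprime n m).2 h), one_mul]
    · rw [MulChar.map_nonunit _ (fun hu => h ((ZMod.isUnit_iff_coprime n m).1 hu)), zero_mul, ofReal_zero]
  have hcd : ∀ χ : DirichletCharacter ℂ m, ContDiffAt ℂ j (F χ) s₀ := by
    intro χ
    have hne1 : ∀ z ∈ {w : ℂ | 1 < w.re}, z ≠ 1 := by
      rintro z hz rfl; simp at hz
    have hop : IsOpen {w : ℂ | 1 < w.re} := isOpen_lt continuous_const continuous_re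
    have hd : DifferentiableOn ℂ χ.LFunction {w : ℂ | 1 < w.re} := fun z hz =>
      (DirichletCharacter.differentiableAt_LFunction χ z (Or.inl (hne1 z hz))).differentiableWithinAt
    have hd' := hd.deriv hop
    have : DifferentiableOn ℂ (F χ) {w : ℂ | 1 < w.re} := by
      refine hd'.div hd fun z hz => ?_
      exact DirichletCharacter.LFunction_ne_zero_of_one_le_re χ (Or.inr (hne1 z hz)) (le_of_lt hz)
    exact (this.analyticAt hnhds).contDiffAt
  rw [hida.iteratedDeriv_eq, iteratedDeriv_const_mul_field, iteratedDeriv_fun_sum (fun χ _ => hcd χ)] at ha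
  rw [hidb.iteratedDeriv_eq, iteratedDeriv_fun_neg] at hb
  have hφ : (m.totient : ℂ) ≠ 0 := by
    exact_mod_cast (Nat.totient_pos.2 (NeZero.pos m)).ne'
  classical
  have e : ((m.totient * ∑' n, ArithmeticFunction.vonMangoldt.residueClass (1 : ZMod m) n * wt δ j n
      - ∑' n, (if n.Coprime m then vonMangoldt n else 0) * wt δ j n : ℝ) : ℂ) =
      -((-1) ^ j * ∑ χ ∈ Finset.univ.erase (1 : DirichletCharacter ℂ m), iteratedDeriv j (F χ) s₀) := by
    rw [ofReal_sub, ofReal_mul, ← ha, ← hb, ← Finset.add_sum_erase _ _ (Finset.mem_univ (1 : DirichletCharacter ℂ m))]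
    push_cast
    field_simp
    ring
  rw [← Real.norm_eq_abs, ← norm_real, e, norm_neg, norm_mul, norm_pow, norm_neg, norm_one, one_pow,
      one_mul]
  have hcard : Fintype.card (DirichletCharacter ℂ m) = m.totient := by
    rw [← Nat.card_eq_fintype_card]
    exact DirichletCharacter.card_eq_totient_of_hasEnoughRootsOfUnity ℂ m
  calc _ ≤ ∑ χ ∈ Finset.univ.erase (1 : DirichletCharacter ℂ m), (j.factorial * (4 * V ^ 10) ^ (j + 1) : ℝ) := by
        refine norm_sum_le_of_le _ fun χ hχ => ?_
        have h1 : χ ≠ 1 := Finset.ne_of_mem_erase hχ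
        have := nontriv_bound h1 hV (hg χ h1) j
        rw [hs₀, hδ]
        exact this
    _ ≤ ∑ χ : DirichletCharacter ℂ m, (j.factorial * (4 * V ^ 10) ^ (j + 1) : ℝ) := by
        refine Finset.sum_le_sum_of_subset_of_nonneg (Finset.erase_subset _ _) fun _ _ _ => by positivity
    _ = _ := by rw [Finset.sum_const, Finset.card_univ, hcard, nsmul_eq_mul]

end Carm

namespace Carm
open Complex
open ArithmeticFunction (vonMangoldt)

lemma T_pre {m : ℕ} [NeZero m] {V : ℝ} (hV : C0 * (1 + Real.log m) ≤ V) (hg : Good V m) (j : ℕ)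
    {δ : ℝ} (hδ : δ = 1 / (16 * V ^ 10)) {B : ℝ} (hB : ∀ δ : ℝ, 0 < δ → δ ≤ 1 / B → ∀ j : ℕ,
    |∑' n, vonMangoldt n * wt δ j n - j.factorial / δ ^ (j + 1)| ≤ j.factorial * B ^ (j + 1))
    (hδB : δ ≤ 1 / B) :
    Summable (tf δ j m) ∧ |m.totient * ∑' n, tf δ j m n - j.factorial / δ ^ (j + 1)| ≤
      m.totient * (j.factorial * (4 * V ^ 10) ^ (j + 1)) + j.factorial * B ^ (j + 1) +
      (m.totient + 1) * (((j + 1).factorial * 4 ^ (j + 1)) * ∑' n, npw n) + j.factorial * Real.log m := by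
  have hV2 := V_ge hV
  have hδ0 : 0 < δ := by rw [hδ]; positivity
  have h1 := char_ineq hV hg j hδ
  have h2 := hB δ hδ0 hδB j
  set K : ℝ := ((j + 1).factorial * 4 ^ (j + 1)) with hK
  have hK0 : 0 ≤ K := by positivity
  have hnp : Summable (fun n => K * npw n) := npw_summable.mul_left K
  have hΛ0 : ∀ n, 0 ≤ vonMangoldt n := fun n => ArithmeticFunction.vonMangoldt_nonneg
  obtain ⟨sfull, -⟩ := series_real (f := fun n => vonMangoldt n) hΛ0 (fun n => le_rfl) hδ0 j
  obtain ⟨sa, -⟩ := series_real (f := ArithmeticFunction.vonMangoldt.residueClass (1 : ZMod m))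
    (fun n => ArithmeticFunction.vonMangoldt.residueClass_nonneg _ n)
    (fun n => ArithmeticFunction.vonMangoldt.residueClass_le _ n) hδ0 j
  obtain ⟨sb, -⟩ := series_real (f := fun n => if n.Coprime m then vonMangoldt n else 0)
    (fun n => by split_ifs; exacts [ArithmeticFunction.vonMangoldt_nonneg, le_rfl])
    (fun n => by split_ifs; exacts [le_rfl, ArithmeticFunction.vonMangoldt_nonneg]) hδ0 j
  have htf1 : ∀ n, tf δ j m n ≤ ArithmeticFunction.vonMangoldt.residueClass (1 : ZMod m) n * wt δ j n := by
    intro n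
    unfold tf
    split_ifs with h
    · rw [ArithmeticFunction.vonMangoldt.residueClass, Set.indicator_of_mem (by exact h.2),
        ArithmeticFunction.vonMangoldt_apply_prime h.1, wt_succ]
    · exact mul_nonneg (ArithmeticFunction.vonMangoldt.residueClass_nonneg _ n) (wt_nonneg _ _ _)
  have htf2 : ∀ n, ArithmeticFunction.vonMangoldt.residueClass (1 : ZMod m) n * wt δ j n ≤
      tf δ j m n + K * npw n := by
    intro n
    have hn0 := npw_nonneg n
    by_cases hp : n.Prime
    · unfold tf
      by_cases hc : (n : ZMod m) = 1
      · rw [if_pos ⟨hp, hc⟩, ArithmeticFunction.vonMangoldt.residueClass, Set.indicator_of_mem (by exact hc),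
          ArithmeticFunction.vonMangoldt_apply_prime hp, wt_succ]
        have := mul_nonneg hK0 hn0
        linarith
      · rw [ArithmeticFunction.vonMangoldt.residueClass, Set.indicator_of_notMem (by exact hc), zero_mul,
          if_neg (fun h => hc h.2)]
        positivity
    · have h3 := np_bound hδ0 j n hp
      have h4 := mul_le_mul_of_nonneg_right (ArithmeticFunction.vonMangoldt.residueClass_le (1 : ZMod m) n)
        (wt_nonneg δ j n)
      have h5 := tf_nonneg δ j m n
      linarith
  have st : Summable (tf δ j m) := Summable.of_nonneg_of_le (tf_nonneg δ j m) htf1 sa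
  refine ⟨st, ?_⟩
  have i1 := st.tsum_le_tsum htf1 sa
  have i2 := sa.tsum_le_tsum htf2 (st.add hnp)
  rw [st.tsum_add hnp, tsum_mul_left] at i2
  have i3 : ∑' n, (if n.Coprime m then vonMangoldt n else 0) * wt δ j n ≤ ∑' n, vonMangoldt n * wt δ j n := by
    refine sb.tsum_le_tsum (fun n => mul_le_mul_of_nonneg_right ?_ (wt_nonneg _ _ _)) sfull
    split_ifs
    · exact le_rfl
    · exact hΛ0 n
  have i4 : ∑' n, vonMangoldt n * wt δ j n ≤ ∑' n, (if n.Coprime m then vonMangoldt n else 0) * wt δ j n +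
      K * ∑' n, npw n + j.factorial * Real.log m := by
    set D : ℕ → ℝ := fun n => if n ∈ m.primeFactors then Real.log n * j.factorial else 0 with hD
    have sD : HasSum D (∑ n ∈ m.primeFactors, D n) :=
      hasSum_sum_of_ne_finset_zero (fun n hn => by simp only [hD]; rw [if_neg hn])
    have hDle : ∑ n ∈ m.primeFactors, D n ≤ j.factorial * Real.log m := by
      rw [Finset.sum_congr rfl (g := fun n : ℕ => Real.log n * j.factorial)
        (fun n hn => by simp only [hD]; rw [if_pos hn]), ← Finset.sum_mul, mul_comm]
      gcongr
      exact sum_log_primeFactors_le (NeZero.ne m)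
    have i5 := sfull.tsum_le_tsum (g := fun n => (if n.Coprime m then vonMangoldt n else 0) * wt δ j n +
      K * npw n + D n) (fun n => ?_) ((sb.add hnp).add sD.summable)
    · rw [(sb.add hnp).tsum_add sD.summable, sb.tsum_add hnp, tsum_mul_left, sD.tsum_eq] at i5
      linarith
    · have hn0 := mul_nonneg hK0 (npw_nonneg n)
      have hD0 : 0 ≤ D n := by
        simp only [hD]; split_ifs
        · have := Real.log_natCast_nonneg n; positivity
        · exact le_rfl
      by_cases hc : n.Coprime m
      · rw [if_pos hc]; linarith
      · rw [if_neg hc, zero_mul]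
        by_cases hp : n.Prime
        · have hmem : n ∈ m.primeFactors := by
            rw [Nat.mem_primeFactors]
            exact ⟨hp, by_contra fun h => hc ((Nat.Prime.coprime_iff_not_dvd hp).2 h), NeZero.ne m⟩
          have : D n = Real.log n * j.factorial := by simp only [hD]; rw [if_pos hmem]
          rw [this, ArithmeticFunction.vonMangoldt_apply_prime hp]
          have h6 := mul_le_mul_of_nonneg_left (wt_le_fact hδ0 j n hp.one_le) (Real.log_natCast_nonneg n)
          linarith
        · have := np_bound hδ0 j n hp
          linarith
  have hφ : (0 : ℝ) ≤ m.totient := by positivity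
  have j1 := mul_le_mul_of_nonneg_left i1 hφ
  have j2 := mul_le_mul_of_nonneg_left i2 hφ
  have j0 : 0 ≤ (j.factorial : ℝ) * Real.log m := mul_nonneg (by positivity) (Real.log_natCast_nonneg m)
  have j3 : 0 ≤ K * ∑' n, npw n := mul_nonneg hK0 (tsum_nonneg npw_nonneg)
  have j4 := mul_nonneg hφ j3
  rw [abs_le] at h1 h2 ⊢
  constructor <;> linarith [h1.1, h1.2, h2.1, h2.2]

set_option maxHeartbeats 2000000 in
lemma T_asymp : ∃ C1 : ℝ, C0 ≤ C1 ∧ ∀ (m : ℕ) [NeZero m] (V : ℝ), C1 * (1 + Real.log m) ≤ V → Good V m →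
    ∀ j : ℕ, V ≤ j → ∀ δ : ℝ, δ = 1 / (16 * V ^ 10) → 
    Summable (tf δ j m) ∧ (j.factorial / δ ^ (j + 1)) / (2 * m.totient) ≤ ∑' n, tf δ j m n ∧
      ∑' n, tf δ j m n ≤ 3 * (j.factorial / δ ^ (j + 1)) / (2 * m.totient) := by
  obtain ⟨B, hB1, hB⟩ := zeta_bound
  set c := ∑' n, npw n with hc
  have hc0 : 0 ≤ c := tsum_nonneg npw_nonneg
  have hC0 := C0_ge
  refine ⟨C0 + B + c, by linarith, fun m _ V hV hg j hj δ hδ => ?_⟩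
  have hl : 0 ≤ Real.log m := Real.log_natCast_nonneg m
  have hV1 : C0 * (1 + Real.log m) ≤ V := le_trans (by gcongr; linarith) hV
  have hV2 := V_ge hV1
  have hV10 : V ≤ V ^ 10 := le_self_pow₀ (by linarith) (by norm_num)
  have hVB : B + c ≤ V := by nlinarith
  have hδ0 : 0 < δ := by rw [hδ]; positivity
  have hδB : δ ≤ 1 / B := by
    rw [hδ]
    exact one_div_le_one_div_of_le (by linarith) (by linarith)
  obtain ⟨hs, hT⟩ := T_pre hV1 hg j hδ hB hδB
  refine ⟨hs, ?_⟩
  set A := (j.factorial / δ ^ (j + 1) : ℝ) with hA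
  set E := 4 * V ^ 10 with hE
  have hE1 : 800 ≤ E := by linarith
  have hAE : A = j.factorial * (4 * E) ^ (j + 1) := by
    rw [hA, hδ, one_div, inv_pow, div_inv_eq_mul, hE]; ring
  have hf : (1 : ℝ) ≤ j.factorial := by exact_mod_cast Nat.succ_le_of_lt (Nat.factorial_pos j)
  have hmpos : (1 : ℝ) ≤ m := by exact_mod_cast NeZero.one_le
  have hφ1 : (1 : ℝ) ≤ m.totient := by exact_mod_cast Nat.totient_pos.2 (NeZero.pos m)
  have hφm : (m.totient : ℝ) ≤ m := by exact_mod_cast Nat.totient_le m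
  -- m ≤ 2 ^ j
  have hm2 : (m : ℝ) ≤ 2 ^ j := by
    rw [← Real.log_le_log_iff (by positivity) (by positivity), Real.log_pow]
    have := Real.log_two_gt_d9
    nlinarith
  have h16 : (200:ℝ) ≤ 2 ^ j := by
    have : (j : ℝ) < 2 ^ j := by exact_mod_cast Nat.lt_two_pow_self
    linarith
  have hj1 : (j : ℝ) + 1 ≤ 2 ^ j := by exact_mod_cast Nat.lt_two_pow_self
  have h4j : (4 : ℝ) ^ (j + 1) = 4 * (2 ^ j * 2 ^ j) := by
    rw [← mul_pow, pow_succ]; norm_num; ring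
  have hEp : 0 < E ^ (j + 1) := by positivity
  have hAE' : A = j.factorial * (4 * (2 ^ j * 2 ^ j)) * E ^ (j + 1) := by
    rw [hAE, mul_pow, h4j]; ring
  have hA0 : 0 < A := by rw [hAE']; positivity
  set X : ℝ := 2 ^ j with hX
  set F : ℝ := (j.factorial : ℝ) with hF
  have t1 : m.totient * (F * E ^ (j + 1)) ≤ A / 16 := by
    rw [hAE']
    have : m.totient * (F * E ^ (j + 1)) ≤ X * (F * E ^ (j + 1)) := by gcongr; linarith
    refine this.trans ?_
    have : 0 < F * E ^ (j + 1) * X := by positivity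
    nlinarith
  have t2 : F * B ^ (j + 1) ≤ A / 16 := by
    rw [hAE']
    have : F * B ^ (j + 1) ≤ F * E ^ (j + 1) := by gcongr; linarith
    refine this.trans ?_
    have : 0 < F * E ^ (j + 1) := by positivity
    nlinarith
  have hEj : X * X ≤ E ^ j := by
    rw [hX, ← mul_pow]; gcongr; linarith
  have t3 : (m.totient + 1) * (((j + 1).factorial * 4 ^ (j + 1)) * c) ≤ A / 16 := by
    rw [hAE', Nat.factorial_succ, h4j]
    push_cast
    have a1 : ((m.totient : ℝ) + 1) * ((((j : ℝ) + 1) * F * (4 * (X * X))) * c) ≤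
        (2 * X) * (((X * F) * (4 * (X * X))) * V) := by
      gcongr <;> linarith
    refine a1.trans ?_
    have a2 : X * X * E ≤ E ^ (j + 1) := by rw [pow_succ]; gcongr
    have a3 : F * (4 * (X * X)) * (X * X * E) / 16 ≤ F * (4 * (X * X)) * E ^ (j + 1) / 16 := by gcongr
    refine le_trans ?_ a3
    have a4 : 2 * V ≤ E / 16 := by
      have : V ^ 2 ≤ V ^ 10 := pow_le_pow_right₀ (by linarith) (by norm_num)
      rw [hE]; nlinarith
    have : (2 * X) * (((X * F) * (4 * (X * X))) * V) = (F * (4 * (X * X)) * (X * X)) * (2 * V) := by ring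
    rw [this]
    have : F * (4 * (X * X)) * (X * X * E) / 16 = (F * (4 * (X * X)) * (X * X)) * (E / 16) := by ring
    rw [this]
    gcongr
  have t4 : F * Real.log m ≤ A / 16 := by
    rw [hAE']
    have b1 : Real.log m ≤ X := (Real.log_le_self (by linarith)).trans hm2
    have b2 : 1 ≤ E ^ (j + 1) := one_le_pow₀ (by linarith)
    have b3 : F * Real.log m ≤ F * X := by gcongr
    refine b3.trans ?_
    have : F * (4 * (X * X)) * 1 / 16 ≤ F * (4 * (X * X)) * E ^ (j + 1) / 16 := by gcongr
    refine le_trans ?_ this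
    have : 0 < F * X := by positivity
    nlinarith
  have hT2 : |m.totient * ∑' n, tf δ j m n - A| ≤ A / 2 := by linarith
  rw [abs_le] at hT2
  constructor
  · rw [div_le_iff₀ (by positivity)]; linarith [hT2.1]
  · rw [le_div_iff₀ (by positivity)]; linarith [hT2.2]

end Carm

namespace Carm
open Complex

lemma wt_le3 {δ : ℝ} (hδ : 0 < δ) (j : ℕ) {η : ℝ} (hη : η = δ / (j + 2)) {x : ℕ} (hx : 1 ≤ x) :
    wt δ (j + 1) x ≤ 3 * (j + 1) * (j.factorial / δ ^ (j + 1)) / (x : ℝ) ^ (1 + η) := by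
  have hx' : (1 : ℝ) ≤ x := by exact_mod_cast hx
  have h := pow_log_le hx' (j + 1) (c := (1 + 1 / (j + 1)) / δ) (by positivity)
  have h1 : (1 + 1 / ((j : ℝ) + 1)) ^ (j + 1) ≤ 3 := by
    have h2 := Real.add_one_le_exp (1 / ((j : ℝ) + 1))
    calc _ ≤ (Real.exp (1 / ((j : ℝ) + 1))) ^ (j + 1) := by gcongr; linarith
      _ = Real.exp 1 := by
        rw [← Real.exp_nat_mul]; congr 1; push_cast; field_simp
      _ ≤ 3 := by have := Real.exp_one_lt_d9; linarith
  have e : 1 / ((1 + 1 / ((j : ℝ) + 1)) / δ) = δ - η := by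
    rw [hη]; field_simp; ring
  rw [e, div_pow, Nat.factorial_succ] at h
  push_cast at h
  unfold wt
  rw [div_le_div_iff₀ (by positivity) (by positivity)]
  have e2 : (x : ℝ) ^ (1 + δ) = (x : ℝ) ^ (δ - η) * (x : ℝ) ^ (1 + η) := by
    rw [← Real.rpow_add (by positivity)]; congr 1; ring
  rw [e2]
  calc _ ≤ ((((j : ℝ) + 1) * j.factorial) * ((1 + 1 / ((j : ℝ) + 1)) ^ (j + 1) / δ ^ (j + 1)) * (x : ℝ) ^ (δ - η)) * (x : ℝ) ^ (1 + η) := by gcongr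
    _ ≤ ((((j : ℝ) + 1) * j.factorial) * (3 / δ ^ (j + 1)) * (x : ℝ) ^ (δ - η)) * (x : ℝ) ^ (1 + η) := by gcongr
    _ = _ := by ring

lemma dwt_le {δ : ℝ} (hδ : 0 < δ) (j : ℕ) {η : ℝ} (hη : η = δ / (j + 2)) {d k : ℕ} (hd : 1 ≤ d) :
    d * wt δ (j + 1) (d * (k + 1) + 1) ≤
      3 * (j + 1) * (j.factorial / δ ^ (j + 1)) * (1 / ((k : ℝ) + 1) ^ (1 + η)) := by
  have hη0 : 0 < η := by rw [hη]; positivity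
  have h := wt_le3 hδ j hη (x := d * (k + 1) + 1) (by omega)
  have hd' : (1 : ℝ) ≤ d := by exact_mod_cast hd
  calc _ ≤ d * (3 * (j + 1) * (j.factorial / δ ^ (j + 1)) / ((d * (k + 1) + 1 : ℕ) : ℝ) ^ (1 + η)) := by gcongr
    _ ≤ d * (3 * (j + 1) * (j.factorial / δ ^ (j + 1)) / (d * ((k : ℝ) + 1) ^ (1 + η))) := by
      gcongr
      push_cast
      calc d * ((k : ℝ) + 1) ^ (1 + η) ≤ (d : ℝ) ^ (1 + η) * ((k : ℝ) + 1) ^ (1 + η) := by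
            gcongr
            exact Real.self_le_rpow_of_one_le hd' (by linarith)
        _ = (d * ((k : ℝ) + 1)) ^ (1 + η) := by rw [Real.mul_rpow (by positivity) (by positivity)]
        _ ≤ _ := by
          refine Real.rpow_le_rpow (by positivity) (by linarith) (by linarith)
    _ = _ := by field_simp

lemma pigeon {δ : ℝ} (hδ : 0 < δ) (j : ℕ) {η : ℝ} (hη : η = δ / (j + 2)) (D : Finset ℕ)
    (hD : D.Nonempty) (hpos : ∀ d ∈ D, 1 ≤ d) (S : ℕ → Prop) [DecidablePred S]
    (H : ∀ d ∈ D, (j.factorial / δ ^ (j + 1)) / (4 * d) ≤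
      ∑' k, if (d * k + 1).Prime ∧ S k then wt δ (j + 1) (d * k + 1) else 0) :
    ∃ k : ℕ, 1 ≤ k ∧ S k ∧ (k : ℝ) ≤ Real.exp (96 * (j + 1) * (1 + 2 / η) / η) ∧
      (D.card : ℝ) ≤ (D.filter (fun d => (d * k + 1).Prime)).card * (48 * (j + 1) * (1 + 2 / η)) := by
  by_contra hcon
  push Not at hcon
  have hη0 : 0 < η := by rw [hη]; positivity
  set A : ℝ := (j.factorial / δ ^ (j + 1) : ℝ) with hA
  have hA0 : 0 < A := by positivity
  set C : ℝ := 48 * (j + 1) * (1 + 2 / η) with hC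
  have hCpos : 0 < C := by positivity
  have hDc : (0 : ℝ) < D.card := by exact_mod_cast hD.card_pos
  set g : ℕ → ℕ → ℝ := fun d k => if (d * (k + 1) + 1).Prime ∧ S (k + 1) then wt δ (j + 1) (d * (k + 1) + 1) else 0 with hg
  have hg0 : ∀ d k, 0 ≤ g d k := fun d k => by
    simp only [hg]; split_ifs
    · exact wt_nonneg _ _ _
    · exact le_rfl
  have s1 := summable_rpow_shift hη0
  have s2 := summable_rpow_shift (half_pos hη0)
  have hgle : ∀ d ∈ D, ∀ k, d * g d k ≤ 3 * (j + 1) * A * (1 / ((k : ℝ) + 1) ^ (1 + η)) := by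
    intro d hd k
    have := dwt_le hδ j hη (d := d) (k := k) (hpos d hd)
    simp only [hg]
    split_ifs
    · exact this
    · rw [mul_zero]; positivity
  have hgs : ∀ d ∈ D, Summable (fun k => (d : ℝ) * g d k) := fun d hd =>
    Summable.of_nonneg_of_le (fun k => mul_nonneg (by positivity) (hg0 d k)) (hgle d hd) (s1.mul_left _)
  have hH : ∀ d ∈ D, A / 4 ≤ ∑' k, d * g d k := by
    intro d hd
    have hd0 : (0 : ℝ) < d := by exact_mod_cast hpos d hd
    have h1 := H d hd
    have hsum' : Summable (fun k => g d k) := by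
      have := (hgs d hd).mul_left (d : ℝ)⁻¹
      refine this.congr fun k => ?_
      field_simp
    have h2 : ∑' k, (if (d * k + 1).Prime ∧ S k then wt δ (j + 1) (d * k + 1) else 0) = ∑' k, g d k := by
      rw [Summable.tsum_eq_zero_add]
      · simp [hg, Nat.not_prime_one]
      · rw [← summable_nat_add_iff 1]
        exact hsum'
    rw [h2, div_le_iff₀ (by positivity)] at h1
    rw [tsum_mul_left]
    linarith
  have hsum : D.card * (A / 4) ≤ ∑' k, ∑ d ∈ D, (d : ℝ) * g d k := by
    rw [Summable.tsum_finsetSum hgs, ← nsmul_eq_mul]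
    exact Finset.card_nsmul_le_sum _ _ _ hH
  have hpt : ∀ k, ∑ d ∈ D, (d : ℝ) * g d k ≤ (3 * (j + 1) * A * (D.card / C)) *
      (1 / ((k : ℝ) + 1) ^ (1 + η) + 1 / ((k : ℝ) + 1) ^ (1 + η / 2)) := by
    intro k
    have hk1 : (1 : ℝ) ≤ (k : ℝ) + 1 := by have : (0 : ℝ) ≤ k := by positivity
                                           linarith
    by_cases hS : S (k + 1)
    swap
    · have : ∑ d ∈ D, (d : ℝ) * g d k = 0 := Finset.sum_eq_zero fun d _ => by simp [hg, hS]
      rw [this]; positivity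
    set N := (D.filter (fun d => (d * (k + 1) + 1).Prime)).card with hN
    have h1 : ∑ d ∈ D, (d : ℝ) * g d k ≤ N * (3 * (j + 1) * A * (1 / ((k : ℝ) + 1) ^ (1 + η))) := by
      rw [hN, ← nsmul_eq_mul, ← Finset.sum_const, Finset.sum_filter]
      refine Finset.sum_le_sum fun d hd => ?_
      split_ifs with hp
      · exact hgle d hd k
      · simp [hg, hp]
    have h2 : (N : ℝ) ≤ (D.card / C) * (1 + ((k : ℝ) + 1) ^ (η / 2)) := by
      by_cases hk : ((k + 1 : ℕ) : ℝ) ≤ Real.exp (96 * (j + 1) * (1 + 2 / η) / η)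
      · have h3 := hcon (k + 1) (by omega) hS hk
        rw [← hN, ← lt_div_iff₀ hCpos] at h3
        have : 0 ≤ (D.card / C) * ((k : ℝ) + 1) ^ (η / 2) := by positivity
        linarith
      · push Not at hk
        have h3 : (N : ℝ) ≤ D.card := by exact_mod_cast Finset.card_filter_le _ _
        have h4 : C ≤ ((k : ℝ) + 1) ^ (η / 2) := by
          calc C ≤ Real.exp C := by have := Real.add_one_le_exp C; linarith
            _ = (Real.exp (96 * (j + 1) * (1 + 2 / η) / η)) ^ (η / 2) := by
              rw [← Real.exp_mul]; congr 1; rw [hC]; field_simp; norm_num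
            _ ≤ _ := by
              push_cast at hk
              exact Real.rpow_le_rpow (by positivity) hk.le (by positivity)
        calc (N : ℝ) ≤ (D.card / C) * C := by rw [div_mul_cancel₀ _ hCpos.ne']; exact h3
          _ ≤ _ := by gcongr; linarith
    calc _ ≤ _ := h1
      _ ≤ ((D.card / C) * (1 + ((k : ℝ) + 1) ^ (η / 2))) * (3 * (j + 1) * A * (1 / ((k : ℝ) + 1) ^ (1 + η))) := by gcongr
      _ = (3 * (j + 1) * A * (D.card / C)) *
        (1 / ((k : ℝ) + 1) ^ (1 + η) + ((k : ℝ) + 1) ^ (η / 2) / ((k : ℝ) + 1) ^ (1 + η)) := by ring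
      _ = _ := by
        congr 2
        rw [← Real.rpow_sub (by positivity), one_div, ← Real.rpow_neg (by positivity)]
        congr 1; ring
  have hfin := (summable_sum hgs).tsum_le_tsum hpt ((s1.add s2).mul_left _)
  rw [tsum_mul_left, s1.tsum_add s2] at hfin
  have t1 := tsum_rpow_le hη0
  have t2 := tsum_rpow_le (half_pos hη0)
  have hη1 : 0 < 1 / η := by positivity
  have e1 : 1 / (η / 2) = 2 / η := by field_simp
  have e2 : 2 / η = 2 * (1 / η) := by ring
  rw [e1] at t2
  have t3 : (3 * (j + 1) * A * (D.card / C)) * (∑' n : ℕ, 1 / ((n : ℝ) + 1) ^ (1 + η) + ∑' n : ℕ, 1 / ((n : ℝ) + 1) ^ (1 + η / 2)) ≤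
      (3 * (j + 1) * A * (D.card / C)) * (2 * (1 + 2 / η)) := by gcongr; linarith
  have t4 : (3 * (j + 1) * A * (D.card / C)) * (2 * (1 + 2 / η)) = D.card * (A / 8) := by
    rw [hC]; field_simp; norm_num
  have t5 : 0 < D.card * A := by positivity
  linarith

end Carm

namespace Carm
open Complex

/-- prime weight -/
noncomputable def pw (δ : ℝ) (j x : ℕ) : ℝ := if x.Prime then wt δ (j + 1) x else 0

lemma pw_nonneg (δ : ℝ) (j x : ℕ) : 0 ≤ pw δ j x := by
  unfold pw; split_ifs
  · exact wt_nonneg _ _ _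
  · exact le_rfl

lemma reindex (δ : ℝ) (j : ℕ) {d : ℕ} (hd : 1 ≤ d) (hs : Summable (tf δ j d)) :
    Summable (fun k => pw δ j (d * k + 1)) ∧ ∑' k, pw δ j (d * k + 1) = ∑' n, tf δ j d n := by
  have hinj : Function.Injective (fun k : ℕ => d * k + 1) := by
    intro a b hab
    have : d * a = d * b := by simpa using hab
    exact Nat.eq_of_mul_eq_mul_left hd this
  have e : ∀ k, tf δ j d (d * k + 1) = pw δ j (d * k + 1) := by
    intro k
    unfold tf pw
    have : (((d * k + 1 : ℕ) : ZMod d)) = 1 := by simp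
    simp [this]
  constructor
  · exact (hs.comp_injective hinj).congr fun k => e k
  · rw [← hinj.tsum_eq (f := tf δ j d)]
    · exact tsum_congr fun k => (e k).symm
    · intro n hn
      rw [Function.mem_support] at hn
      unfold tf at hn
      have h : n.Prime ∧ (n : ZMod d) = 1 := by
        by_contra h; rw [if_neg h] at hn; exact hn rfl
      have h1 : ((n - 1 : ℕ) : ZMod d) = 0 := by
        rw [Nat.cast_sub h.1.one_le, h.2]; simp
      rw [ZMod.natCast_eq_zero_iff] at h1
      obtain ⟨k, hk⟩ := h1
      refine ⟨k, ?_⟩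
      have := h.1.one_le
      simp only
      omega

lemma stage : ∃ C1 : ℝ, C0 ≤ C1 ∧ ∀ (V : ℝ) (D Q : Finset ℕ), 200 ≤ V → D.Nonempty →
    (∀ q ∈ Q, q.Prime ∧ 100 * Q.card ≤ q - 1) →
    (∀ d ∈ D, 1 ≤ d ∧ C1 * (1 + Real.log d) ≤ V ∧ (∀ [NeZero d], Good V d) ∧
      ∀ q ∈ Q, C1 * (1 + Real.log (d * q : ℕ)) ≤ V ∧ (∀ [NeZero (d * q)], Good V (d * q))) →
    ∃ k : ℕ, 1 ≤ k ∧ (∀ q ∈ Q, ¬ q ∣ k) ∧ (k : ℝ) ≤ Real.exp (V ^ 26) ∧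
      (D.card : ℝ) ≤ (D.filter (fun d => (d * k + 1).Prime)).card * V ^ 14 := by
  classical
  obtain ⟨C1, hC1, hT⟩ := T_asymp
  refine ⟨C1, hC1, fun V D Q hV200 hDne hQ hD => ?_⟩
  set j := ⌈V⌉₊ with hj
  have hjV : V ≤ j := Nat.le_ceil V
  have hjV' : (j : ℝ) < V + 1 := Nat.ceil_lt_add_one (by linarith)
  set δ := 1 / (16 * V ^ 10) with hδ
  have hδ0 : 0 < δ := by positivity
  set A : ℝ := (j.factorial / δ ^ (j + 1) : ℝ) with hA
  have hA0 : 0 < A := by positivity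
  have hmain := pigeon hδ0 j rfl D hDne (fun d hd => (hD d hd).1) (fun k => ∀ q ∈ Q, ¬ q ∣ k) ?_
  · obtain ⟨k, hk1, hkS, hkle, hcard⟩ := hmain
    have hb1 : (j : ℝ) + 1 ≤ 2 * V := by linarith
    have hb2 : 1 / (δ / (j + 2)) ≤ 32 * V ^ 11 := by
      rw [hδ]
      have : 1 / (1 / (16 * V ^ 10) / ((j : ℝ) + 2)) = ((j : ℝ) + 2) * (16 * V ^ 10) := by field_simp
      rw [this]
      calc _ ≤ (2 * V) * (16 * V ^ 10) := by gcongr; linarith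
        _ = _ := by ring
    have hb3 : 1 + 2 / (δ / (j + 2)) ≤ 65 * V ^ 11 := by
      have h1 : (1 : ℝ) ≤ V ^ 11 := one_le_pow₀ (by linarith)
      have : 2 / (δ / ((j : ℝ) + 2)) = 2 * (1 / (δ / (j + 2))) := by ring
      rw [this]; linarith
    refine ⟨k, hk1, hkS, hkle.trans ?_, hcard.trans ?_⟩
    · apply Real.exp_le_exp.2
      have : 96 * ((j : ℝ) + 1) * (1 + 2 / (δ / (j + 2))) / (δ / (j + 2)) =
        96 * ((j : ℝ) + 1) * (1 + 2 / (δ / (j + 2))) * (1 / (δ / (j + 2))) := by ring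
      rw [this]
      calc _ ≤ 96 * (2 * V) * (65 * V ^ 11) * (32 * V ^ 11) := by gcongr
        _ = 399360 * V ^ 23 := by ring
        _ ≤ 200 ^ 3 * V ^ 23 := by gcongr; norm_num
        _ ≤ V ^ 3 * V ^ 23 := by gcongr
        _ = _ := by ring
    · gcongr
      calc _ ≤ 48 * (2 * V) * (65 * V ^ 11) := by gcongr
        _ = 6240 * V ^ 12 := by ring
        _ ≤ 200 ^ 2 * V ^ 12 := by gcongr; norm_num
        _ ≤ V ^ 2 * V ^ 12 := by gcongr
        _ = _ := by ring
  · intro d hd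
    obtain ⟨hd1, hdV, hdg, hdq⟩ := hD d hd
    have : NeZero d := ⟨by omega⟩
    have hφ : (0 : ℝ) < d.totient := by exact_mod_cast Nat.totient_pos.2 hd1
    obtain ⟨sd, hlow, -⟩ := hT d V hdV hdg j hjV δ hδ
    obtain ⟨s1, e1⟩ := reindex δ j hd1 sd
    rw [← e1] at hlow
    -- each q
    have hqb : ∀ q ∈ Q, Summable (fun k => if q ∣ k then pw δ j (d * k + 1) else 0) ∧
        ∑' k, (if q ∣ k then pw δ j (d * k + 1) else 0) ≤ (A / d.totient) * (3 / 2 / (100 * Q.card)) := by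
      intro q hq
      obtain ⟨hqp, hqb⟩ := hQ q hq
      obtain ⟨hV, hg⟩ := hdq q hq
      have hqpos := hqp.pos
      have : NeZero (d * q) := ⟨by positivity⟩
      obtain ⟨sq, -, hup⟩ := hT (d * q) V hV hg j hjV δ hδ
      obtain ⟨s2, e2⟩ := reindex δ j (d := d * q) (by have := Nat.mul_pos hd1 hqpos; omega) sq
      have sk : Summable (fun k => if q ∣ k then pw δ j (d * k + 1) else 0) :=
        Summable.of_nonneg_of_le (fun k => by split_ifs; exacts [pw_nonneg _ _ _, le_rfl])
          (fun k => by split_ifs; exacts [le_rfl, pw_nonneg _ _ _]) s1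
      refine ⟨sk, ?_⟩
      have hinj : Function.Injective (fun l : ℕ => q * l) := fun a b hab =>
        Nat.eq_of_mul_eq_mul_left hqpos hab
      have e3 : ∑' k, (if q ∣ k then pw δ j (d * k + 1) else 0) = ∑' l, pw δ j (d * q * l + 1) := by
        rw [← hinj.tsum_eq (f := fun k => if q ∣ k then pw δ j (d * k + 1) else 0)]
        · refine tsum_congr fun l => ?_
          simp [mul_assoc]
        · intro k hk
          rw [Function.mem_support] at hk
          have : q ∣ k := by by_contra h; simp [h] at hk
          obtain ⟨l, rfl⟩ := this
          exact ⟨l, rfl⟩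
      rw [e3, e2]
      refine hup.trans ?_
      have hQpos : (0 : ℝ) < Q.card := by exact_mod_cast Finset.card_pos.2 ⟨q, hq⟩
      have hφ2 : (d.totient : ℝ) * (100 * Q.card) ≤ (d * q).totient := by
        have h1 := Nat.totient_super_multiplicative d q
        rw [Nat.totient_prime hqp] at h1
        have h2 : d.totient * (100 * Q.card) ≤ d.totient * (q - 1) := Nat.mul_le_mul_left _ hqb
        exact_mod_cast h2.trans h1
      calc _ ≤ 3 * A / (2 * ((d.totient : ℝ) * (100 * Q.card))) := by gcongr
        _ = _ := by field_simp
    -- combine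
    have sS : Summable (fun k => if (d * k + 1).Prime ∧ (∀ q ∈ Q, ¬ q ∣ k) then wt δ (j + 1) (d * k + 1) else 0) := by
      refine Summable.of_nonneg_of_le (fun k => by split_ifs; exacts [wt_nonneg _ _ _, le_rfl]) (fun k => ?_) s1
      unfold pw
      split_ifs with h1 h2 h2
      · exact le_rfl
      · exact absurd h1.1 h2
      · exact wt_nonneg _ _ _
      · exact le_rfl
    have hle := s1.tsum_le_tsum (g := fun k => (if (d * k + 1).Prime ∧ (∀ q ∈ Q, ¬ q ∣ k) then wt δ (j + 1) (d * k + 1) else 0)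
        + ∑ q ∈ Q, (if q ∣ k then pw δ j (d * k + 1) else 0)) (fun k => ?_)
        (sS.add (summable_sum fun q hq => (hqb q hq).1))
    · rw [sS.tsum_add (summable_sum fun q hq => (hqb q hq).1), Summable.tsum_finsetSum fun q hq => (hqb q hq).1] at hle
      have h3 := Finset.sum_le_card_nsmul Q _ _ (fun q hq => (hqb q hq).2)
      rw [nsmul_eq_mul] at h3
      have h4 : (Q.card : ℝ) * ((A / d.totient) * (3 / 2 / (100 * Q.card))) ≤ (A / d.totient) * (1 / 4) := by
        rcases Nat.eq_zero_or_pos Q.card with h0 | h0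
        · rw [h0, Nat.cast_zero, zero_mul]; positivity
        · have : (0 : ℝ) < Q.card := by exact_mod_cast h0
          have : (Q.card : ℝ) * ((A / d.totient) * (3 / 2 / (100 * Q.card))) = (A / d.totient) * (3 / 200) := by
            field_simp; norm_num
          rw [this]
          exact mul_le_mul_of_nonneg_left (by norm_num) (by positivity)
      have h5 : A / (4 * d) ≤ (A / d.totient) * (1 / 4) := by
        have : (d.totient : ℝ) ≤ d := by exact_mod_cast Nat.totient_le d
        rw [div_mul_div_comm, mul_one, mul_comm (4 : ℝ)]
        gcongr
      have h6 : A / (2 * d.totient) = (A / d.totient) * (1 / 2) := by field_simp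
      linarith
    · have hsn : ∀ q ∈ Q, (0 : ℝ) ≤ (if q ∣ k then pw δ j (d * k + 1) else 0) := fun q _ => by
        split_ifs; exacts [pw_nonneg _ _ _, le_rfl]
      by_cases hS : ∀ q ∈ Q, ¬ q ∣ k
      · have : (if (d * k + 1).Prime ∧ (∀ q ∈ Q, ¬ q ∣ k) then wt δ (j + 1) (d * k + 1) else 0) = pw δ j (d * k + 1) := by
          unfold pw
          by_cases hp : (d * k + 1).Prime
          · rw [if_pos ⟨hp, hS⟩, if_pos hp]
          · rw [if_neg (fun h => hp h.1), if_neg hp]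
        rw [this]
        have := Finset.sum_nonneg hsn
        linarith
      · push Not at hS
        obtain ⟨q, hq, hqk⟩ := hS
        have h7 := Finset.single_le_sum hsn hq
        rw [if_pos hqk] at h7
        have : (0 : ℝ) ≤ (if (d * k + 1).Prime ∧ (∀ q ∈ Q, ¬ q ∣ k) then wt δ (j + 1) (d * k + 1) else 0) := by
          split_ifs; exacts [wt_nonneg _ _ _, le_rfl]
        linarith

end Carm

namespace Carm
open Complex

lemma prime_step {α ι : Type} [Fintype ι] (r : ℕ) (hr : r.Prime) (I : Finset α) (v : α → ι → ℤ)
    (hc : Fintype.card ι * (r - 1) < I.card) :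
    ∃ J ⊆ I, J.Nonempty ∧ ∀ i, (r : ℤ) ∣ ∑ x ∈ J, v x i := by
  classical
  have : Fact r.Prime := ⟨hr⟩
  set f : ι → MvPolynomial I (ZMod r) := fun i =>
    ∑ x : I, MvPolynomial.C ((v x i : ℤ) : ZMod r) * MvPolynomial.X x ^ (r - 1) with hf
  have hdeg : ∀ i, (f i).totalDegree ≤ r - 1 := by
    intro i
    refine MvPolynomial.totalDegree_finsetSum_le fun x _ => ?_
    refine (MvPolynomial.totalDegree_mul _ _).trans ?_
    rw [MvPolynomial.totalDegree_C, zero_add]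
    refine (MvPolynomial.totalDegree_pow _ _).trans ?_
    rw [MvPolynomial.totalDegree_X, mul_one]
  have hsum : ∑ i, (f i).totalDegree < Fintype.card I := by
    rw [Fintype.card_coe]
    refine lt_of_le_of_lt (Finset.sum_le_card_nsmul _ _ (r - 1) fun i _ => hdeg i) ?_
    rwa [Finset.card_univ, smul_eq_mul]
  have hdvd := char_dvd_card_solutions_of_fintype_sum_lt r hsum
  have hr1 : r - 1 ≠ 0 := by have := hr.two_le; omega
  set Sol := {x : I → ZMod r // ∀ i, MvPolynomial.eval x (f i) = 0} with hSol
  have h0 : ∀ i, MvPolynomial.eval (0 : I → ZMod r) (f i) = 0 := by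
    intro i; simp [hf, hr1]
  have hpos : 0 < Fintype.card Sol := Fintype.card_pos_iff.2 ⟨⟨0, h0⟩⟩
  have hone : 1 < Fintype.card Sol := lt_of_lt_of_le hr.one_lt (Nat.le_of_dvd hpos hdvd)
  obtain ⟨⟨x, hx⟩, hx0⟩ := Fintype.exists_ne_of_one_lt_card hone ⟨0, h0⟩
  have hxne : x ≠ 0 := fun h => hx0 (by simp [h])
  obtain ⟨y, hy⟩ := Function.ne_iff.1 hxne
  refine ⟨(Finset.univ.filter (fun z : I => x z ≠ 0)).map (Function.Embedding.subtype _), ?_, ?_, ?_⟩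
  · intro z hz
    simp only [Finset.mem_map, Function.Embedding.coe_subtype] at hz
    obtain ⟨a, -, rfl⟩ := hz
    exact a.2
  · exact ⟨y, Finset.mem_map.2 ⟨y, by simpa using hy, rfl⟩⟩
  · intro i
    rw [Finset.sum_map, ← ZMod.intCast_zmod_eq_zero_iff_dvd]
    push_cast
    have h1 := hx i
    simp only [hf, map_sum, map_mul, map_pow, MvPolynomial.eval_C, MvPolynomial.eval_X] at h1
    rw [Finset.sum_filter]
    refine Eq.trans ?_ h1
    refine Finset.sum_congr rfl fun z _ => ?_
    split_ifs with hz
    · rw [ZMod.pow_card_sub_one_eq_one hz, mul_one]; rfl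
    · push Not at hz
      rw [hz, zero_pow hr1, mul_zero]

lemma extract {α : Type} [DecidableEq α] (I : Finset α) (R : ℕ) (P : Finset α → Prop)
    (hP : ∀ I' ⊆ I, R ≤ I'.card → ∃ J ⊆ I', J.Nonempty ∧ J.card ≤ R ∧ P J) (t : ℕ)
    (ht : R * t ≤ I.card) :
    ∃ F : Finset (Finset α), F.card = t ∧ (∀ J ∈ F, J ⊆ I ∧ J.Nonempty ∧ J.card ≤ R ∧ P J) ∧
      (F : Set (Finset α)).PairwiseDisjoint id := by
  induction t with
  | zero => exact ⟨∅, by simp⟩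
  | succ t ih =>
    obtain ⟨F, hF1, hF2, hF3⟩ := ih (le_trans (Nat.mul_le_mul_left _ (by omega)) ht)
    have hU : (F.biUnion id).card ≤ t * R := by
      rw [← hF1]; exact Finset.card_biUnion_le_card_mul _ _ _ fun J hJ => (hF2 J hJ).2.2.1
    have hR : R ≤ (I \ F.biUnion id).card := by
      have := Finset.le_card_sdiff (F.biUnion id) I
      rw [mul_add, mul_one] at ht
      have : R * t = t * R := mul_comm _ _
      omega
    obtain ⟨J, hJ1, hJ2, hJ3, hJ4⟩ := hP _ Finset.sdiff_subset hR
    have hdis : ∀ K ∈ F, Disjoint J K := by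
      intro K hK
      rw [Finset.disjoint_left]
      intro a ha haK
      have := hJ1 ha
      rw [Finset.mem_sdiff] at this
      exact this.2 (Finset.mem_biUnion.2 ⟨K, hK, haK⟩)
    have hnot : J ∉ F := by
      intro h
      have := hdis J h
      rw [Finset.disjoint_self_iff_empty] at this
      exact hJ2.ne_empty this
    refine ⟨insert J F, by rw [Finset.card_insert_of_notMem hnot, hF1], ?_, ?_⟩
    · intro K hK
      rcases Finset.mem_insert.1 hK with rfl | hK
      · exact ⟨hJ1.trans Finset.sdiff_subset, hJ2, hJ3, hJ4⟩
      · exact hF2 K hK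
    · rw [Finset.coe_insert]
      refine hF3.insert fun K hK _ => hdis K hK

lemma dav (ι : Type) [Fintype ι] (w : ℕ) (hw : Fintype.card ι ≤ 2 ^ w) (M : ℕ) :
    1 ≤ M → ∀ (α : Type) (I : Finset α) (v : α → ι → ℤ), M ^ (w + 1) ≤ I.card →
    ∃ J ⊆ I, J.Nonempty ∧ J.card ≤ M ^ (w + 1) ∧ ∀ i, (M : ℤ) ∣ ∑ x ∈ J, v x i := by
  classical
  induction M using induction_on_primes with
  | zero => intro h; omega
  | one =>
    intro _ α I v hI
    rw [one_pow] at hI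
    obtain ⟨J, hJ, hJc⟩ := Finset.exists_subset_card_eq hI
    exact ⟨J, hJ, Finset.card_pos.1 (by omega), by simp [hJc], fun i => by simp⟩
  | prime_mul r a hr ih =>
    intro hM α I v hI
    have ha : 1 ≤ a := Nat.pos_of_ne_zero (by rintro rfl; simp at hM)
    have hstep : ∀ I' ⊆ I, r ^ (w + 1) ≤ I'.card → ∃ J ⊆ I', J.Nonempty ∧ J.card ≤ r ^ (w + 1) ∧
        ∀ i, (r : ℤ) ∣ ∑ x ∈ J, v x i := by
      intro I' _ hI'
      obtain ⟨K, hK, hKc⟩ := Finset.exists_subset_card_eq hI'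
      obtain ⟨J, hJ, hJ2, hJ3⟩ := prime_step r hr K v (by
        rw [hKc, pow_succ]
        have h1 : Fintype.card ι ≤ r ^ w := hw.trans (Nat.pow_le_pow_left hr.two_le w)
        have h2 : 0 < r ^ w := Nat.pow_pos hr.pos
        calc _ ≤ r ^ w * (r - 1) := Nat.mul_le_mul_right _ h1
          _ < r ^ w * r := Nat.mul_lt_mul_of_pos_left (by have := hr.pos; omega) h2)
      exact ⟨J, hJ.trans hK, hJ2, (Finset.card_le_card hJ).trans hKc.le, hJ3⟩
    obtain ⟨F, hF1, hF2, hF3⟩ := extract I (r ^ (w + 1)) _ hstep (a ^ (w + 1)) (by rwa [← mul_pow])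
    obtain ⟨G, hG, hGne, hGc, hGd⟩ := ih ha (Finset α) F (fun J i => (∑ x ∈ J, v x i) / r) hF1.ge
    have hGdis : (G : Set (Finset α)).PairwiseDisjoint id := hF3.subset (by exact_mod_cast hG)
    refine ⟨G.biUnion id, ?_, ?_, ?_, ?_⟩
    · exact Finset.biUnion_subset.2 fun J hJ => (hF2 J (hG hJ)).1
    · obtain ⟨J, hJ⟩ := hGne
      obtain ⟨x, hx⟩ := (hF2 J (hG hJ)).2.1
      exact ⟨x, Finset.mem_biUnion.2 ⟨J, hJ, hx⟩⟩
    · refine (Finset.card_biUnion_le_card_mul _ _ (r ^ (w + 1)) fun J hJ => (hF2 J (hG hJ)).2.2.1).trans ?_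
      rw [mul_pow, mul_comm]
      exact Nat.mul_le_mul_left _ hGc
    · intro i
      rw [Finset.sum_biUnion hGdis]
      have : ∑ J ∈ G, ∑ x ∈ id J, v x i = r * ∑ J ∈ G, ((∑ x ∈ J, v x i) / r) := by
        rw [Finset.mul_sum]
        refine Finset.sum_congr rfl fun J hJ => ?_
        rw [Int.mul_ediv_cancel' ((hF2 J (hG hJ)).2.2.2 i)]
        rfl
      rw [this]
      push_cast
      exact mul_dvd_mul_left _ (hGd i)

lemma prod_one (Q : Finset ℕ) (M : ℕ) (hM : 1 ≤ M) (hQ : ∀ q ∈ Q, q.Prime ∧ q - 1 ∣ M) (w : ℕ)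
    (hw : Q.card ≤ 2 ^ w) (I : Finset ℕ) (hI : ∀ p ∈ I, ∀ q ∈ Q, p.Coprime q)
    (hc : M ^ (w + 1) ≤ I.card) :
    ∃ J ⊆ I, J.Nonempty ∧ J.card ≤ M ^ (w + 1) ∧ ∀ q ∈ Q, (∏ p ∈ J, p) ≡ 1 [MOD q] := by
  classical
  have hgen : ∀ q : Q, ∃ g : (ZMod q)ˣ, ∀ u, u ∈ Subgroup.zpowers g := by
    intro q
    have : Fact (q : ℕ).Prime := ⟨(hQ q q.2).1⟩
    exact IsCyclic.exists_generator
  choose g hg using hgen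
  have hex : ∀ (p : ℕ) (q : Q), ∃ e : ℤ, p.Coprime q → ((g q ^ e : (ZMod q)ˣ) : ZMod q) = p := by
    intro p q
    by_cases h : p.Coprime q
    · obtain ⟨e, he⟩ := Subgroup.mem_zpowers_iff.1 (hg q (ZMod.unitOfCoprime p h))
      exact ⟨e, fun _ => by rw [he, ZMod.coe_unitOfCoprime]⟩
    · exact ⟨0, fun h' => absurd h' h⟩
  choose e he using hex
  obtain ⟨J, hJ, hJne, hJc, hJd⟩ := dav Q w (by rwa [Fintype.card_coe]) M hM ℕ I e hc
  refine ⟨J, hJ, hJne, hJc, fun q hq => ?_⟩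
  have : Fact q.Prime := ⟨(hQ q hq).1⟩
  rw [← ZMod.natCast_eq_natCast_iff]
  push_cast
  have h1 : ∏ p ∈ J, (p : ZMod q) = ((g ⟨q, hq⟩ ^ (∑ p ∈ J, e p ⟨q, hq⟩) : (ZMod q)ˣ) : ZMod q) := by
    have h2 : ∀ T : Finset ℕ, (∏ p ∈ T, g ⟨q, hq⟩ ^ (e p ⟨q, hq⟩)) = g ⟨q, hq⟩ ^ (∑ p ∈ T, e p ⟨q, hq⟩) := by
      intro T
      induction T using Finset.induction_on with
      | empty => simp
      | insert a T ha ih => rw [Finset.prod_insert ha, Finset.sum_insert ha, zpow_add, ih]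
    rw [← h2, Units.coe_prod]
    exact Finset.prod_congr rfl fun p hp => (he p ⟨q, hq⟩ (hI p (hJ hp) q hq)).symm
  rw [h1]
  have h3 : g ⟨q, hq⟩ ^ (∑ p ∈ J, e p ⟨q, hq⟩) = 1 := by
    rw [← orderOf_dvd_iff_zpow_eq_one]
    have h4 : orderOf (g ⟨q, hq⟩) ∣ q - 1 := by
      rw [← ZMod.card_units q]; exact orderOf_dvd_card
    have h5 : orderOf (g ⟨q, hq⟩) ∣ M := h4.trans (hQ q hq).2
    exact (Int.natCast_dvd_natCast.2 h5).trans (hJd ⟨q, hq⟩)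
  rw [h3, Units.val_one]

lemma square_subset (Q : Finset ℕ) (M : ℕ) (hM : 1 ≤ M) (hQ : ∀ q ∈ Q, q.Prime ∧ q - 1 ∣ M) (w : ℕ)
    (hw : Q.card ≤ 2 ^ w) (I : Finset ℕ) (hI : ∀ p ∈ I, ∀ q ∈ Q, p.Coprime q)
    (hc : 4 * (M ^ (w + 1)) ^ 3 ≤ I.card) :
    ∃ J ⊆ I, ∃ s, 1 ≤ s ∧ J.card = (2 * s) ^ 2 ∧ ∀ q ∈ Q, (∏ p ∈ J, p) ≡ 1 [MOD q] := by
  classical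
  set N := M ^ (w + 1) with hN
  obtain ⟨F, hF1, hF2, hF3⟩ := extract I N (fun J => ∀ q ∈ Q, (∏ p ∈ J, p) ≡ 1 [MOD q])
    (fun I' hI' hc' => prod_one Q M hM hQ w hw I' (fun p hp => hI p (hI' hp)) hc') (4 * N ^ 2)
    (by
      have : N * (4 * N ^ 2) = 4 * N ^ 3 := by ring
      omega)
  have hN1 : 1 ≤ N := Nat.one_le_pow _ _ hM
  obtain ⟨s, hs, hsc⟩ := Finset.exists_le_card_fiber_of_mul_le_card_of_maps_to
    (s := F) (t := Finset.Icc 1 N) (f := Finset.card) (n := 4 * N)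
    (fun J hJ => Finset.mem_Icc.2 ⟨Finset.card_pos.2 (hF2 J hJ).2.1, (hF2 J hJ).2.2.1⟩)
    (Finset.nonempty_Icc.2 hN1) (by rw [Nat.card_Icc, hF1, Nat.add_sub_cancel]; apply le_of_eq; ring)
  rw [Finset.mem_Icc] at hs
  obtain ⟨G, hG, hGc⟩ := Finset.exists_subset_card_eq (n := 4 * s) (le_trans (by omega) hsc)
  have hGF : ∀ J ∈ G, J ∈ F ∧ J.card = s := fun J hJ => Finset.mem_filter.1 (hG hJ)
  have hGdis : (G : Set (Finset ℕ)).PairwiseDisjoint id :=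
    hF3.subset (fun J hJ => (hGF J hJ).1)
  refine ⟨G.biUnion id, Finset.biUnion_subset.2 fun J hJ => (hF2 J (hGF J hJ).1).1, s, hs.1, ?_, ?_⟩
  · rw [Finset.card_biUnion hGdis, Finset.sum_congr rfl (f := fun J : Finset ℕ => (id J).card) (g := fun _ => s) (fun J hJ => (hGF J hJ).2),
      Finset.sum_const, hGc, smul_eq_mul]; ring
  · intro q hq
    rw [Finset.prod_biUnion hGdis]
    have : ∀ T ⊆ G, ∏ J ∈ T, ∏ p ∈ id J, p ≡ 1 [MOD q] := by
      intro T
      induction T using Finset.induction_on with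
      | empty => intro _; rfl
      | insert a T ha ih =>
        intro hT
        rw [Finset.prod_insert ha]
        have h1 := (hF2 a (hGF a (hT (Finset.mem_insert_self _ _))).1).2.2.2 q hq
        have h2 := ih (fun x hx => hT (Finset.mem_insert_of_mem hx))
        exact h1.mul h2
    exact this G subset_rfl

end Carm

namespace Carm
open Complex

lemma carm_of (J : Finset ℕ) (hJ2 : 2 ≤ J.card) (hp : ∀ p ∈ J, p.Prime)
    (hd : ∀ p ∈ J, p - 1 ∣ (∏ p ∈ J, p) - 1) :
    IsCarmichael (∏ p ∈ J, p) ∧ (∏ p ∈ J, p).primeFactors = J := by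
  set n := ∏ p ∈ J, p with hn
  have hpf : n.primeFactors = J := Nat.primeFactors_prod hp
  have hn0 : 0 < n := Finset.prod_pos fun p h => (hp p h).pos
  refine ⟨⟨?_, ?_, ?_⟩, hpf⟩
  · by_contra h
    have : n = 1 := by omega
    rw [this, Nat.primeFactors_one] at hpf
    rw [← hpf] at hJ2; simp at hJ2
  · intro h
    rw [h.primeFactors] at hpf
    rw [← hpf] at hJ2; simp at hJ2
  · intro a
    rw [hn]
    push_cast
    refine Finset.prod_dvd_of_coprime ?_ ?_
    · intro p h q h' hpq
      exact Nat.isCoprime_iff_coprime.2 ((Nat.coprime_primes (hp p h) (hp q h')).2 hpq)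
    · intro p h
      have : Fact p.Prime := ⟨hp p h⟩
      have hdp := hd p h
      obtain ⟨c, hc⟩ := hdp
      have hnc : n = (p - 1) * c + 1 := by omega
      have e : ∏ i ∈ J, i = n := rfl
      rw [e, hnc, ← ZMod.intCast_zmod_eq_zero_iff_dvd]
      push_cast
      by_cases ha : (a : ZMod p) = 0
      · rw [ha]; simp
      · rw [pow_succ, pow_mul, ZMod.pow_card_sub_one_eq_one ha]; simp

lemma combine (Q : Finset ℕ) (M : ℕ) (hM : 1 ≤ M) (hQ : ∀ q ∈ Q, q.Prime ∧ q - 1 ∣ M) (w : ℕ)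
    (hw : Q.card ≤ 2 ^ w) (k : ℕ) (hk : ∀ q ∈ Q, ¬ q ∣ k) (B : ℕ)
    (D : Finset ℕ) (hD : ∀ d ∈ D, B ≤ d ∧ d ∣ ∏ q ∈ Q, q) (hk1 : 1 ≤ k)
    (hc : 4 * (M ^ (w + 1)) ^ 3 + Q.card ≤ (D.filter (fun d => (d * k + 1).Prime)).card) :
    ∃ n, B ≤ n ∧ IsCarmichael n ∧ ∃ m : ℕ, n.primeFactors.card = m ^ 2 := by
  classical
  set I := ((D.filter (fun d => (d * k + 1).Prime)).image (fun d => d * k + 1)) \ Q with hI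
  have hinj : Function.Injective (fun d : ℕ => d * k + 1) := by
    intro a b hab
    have : a * k = b * k := by simpa using hab
    exact Nat.eq_of_mul_eq_mul_right hk1 this
  have hIc : 4 * (M ^ (w + 1)) ^ 3 ≤ I.card := by
    have h1 := Finset.le_card_sdiff Q ((D.filter (fun d => (d * k + 1).Prime)).image (fun d => d * k + 1))
    rw [Finset.card_image_of_injective _ hinj] at h1
    rw [hI]; omega
  have hImem : ∀ p ∈ I, p.Prime ∧ p ∉ Q ∧ ∃ d ∈ D, p = d * k + 1 := by
    intro p hp
    rw [hI, Finset.mem_sdiff, Finset.mem_image] at hp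
    obtain ⟨⟨d, hd, rfl⟩, hq⟩ := hp
    rw [Finset.mem_filter] at hd
    exact ⟨hd.2, hq, d, hd.1, rfl⟩
  obtain ⟨J, hJ, s, hs, hJc, hJp⟩ := square_subset Q M hM hQ w hw I (fun p hp q hq =>
    (Nat.coprime_primes (hImem p hp).1 (hQ q hq).1).2 (fun h => (hImem p hp).2.1 (h ▸ hq))) hIc
  set n := ∏ p ∈ J, p with hn
  have hJ2 : 2 ≤ J.card := by rw [hJc]; nlinarith
  have hn0 : 0 < n := Finset.prod_pos fun p h => (hImem p (hJ h)).1.pos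
  have hL : ∏ q ∈ Q, q ∣ n - 1 := by
    refine Finset.prod_dvd_of_isRelPrime ?_ ?_
    · intro p h q h' hpq
      exact (Nat.coprime_iff_isRelPrime.1 ((Nat.coprime_primes (hQ p h).1 (hQ q h').1).2 hpq))
    · intro q hq
      exact (Nat.modEq_iff_dvd' hn0).1 (hJp q hq).symm
  have hkn : k ∣ n - 1 := by
    refine (Nat.modEq_iff_dvd' hn0).1 ?_
    have : ∏ p ∈ J, p ≡ ∏ p ∈ J, 1 [MOD k] := by
      rw [← ZMod.natCast_eq_natCast_iff]
      push_cast
      refine Finset.prod_congr rfl fun p hp => ?_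
      obtain ⟨-, -, d, -, rfl⟩ := hImem p (hJ hp)
      simp
    simpa using this.symm
  have hcop : (∏ q ∈ Q, q).Coprime k := Nat.Coprime.prod_left fun q hq =>
    ((hQ q hq).1.coprime_iff_not_dvd).2 (hk q hq)
  obtain ⟨hcarm, hpf⟩ := carm_of J hJ2 (fun p hp => (hImem p (hJ hp)).1) (fun p hp => by
    obtain ⟨-, -, d, hd, rfl⟩ := hImem p (hJ hp)
    rw [Nat.add_sub_cancel]
    have hdL := (hD d hd).2
    exact Nat.Coprime.mul_dvd_of_dvd_of_dvd (Nat.Coprime.coprime_dvd_left hdL hcop) (hdL.trans hL) hkn)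
  refine ⟨n, ?_, hcarm, 2 * s, by rw [hpf, hJc]⟩
  obtain ⟨p, hp⟩ : J.Nonempty := Finset.card_pos.1 (by omega)
  have h1 : p ≤ n := Nat.le_of_dvd hn0 (Finset.dvd_prod_of_mem (fun p => p) hp)
  obtain ⟨-, -, d, hd, rfl⟩ := hImem p (hJ hp)
  have := (hD d hd).1
  nlinarith

end Carm

namespace Carm
open Complex

lemma stage' : ∃ C1 : ℝ, C0 ≤ C1 ∧ ∀ (P : Finset ℕ) (W t : ℕ) (l V : ℝ), 1 ≤ t → t ≤ W → 2 * W ≤ P.card →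
    (∀ p ∈ P, p.Prime ∧ 100 * W ≤ p - 1 ∧ Real.log p ≤ l) → C1 * (1 + 2 * ((t + 1) * l)) ≤ V →
    ∃ Q ⊆ P, Q.card = W ∧ ∃ (k : ℕ) (D : Finset ℕ), 1 ≤ k ∧ (∀ q ∈ Q, ¬ q ∣ k) ∧
      (k : ℝ) ≤ Real.exp (V ^ 26) ∧ (∀ d ∈ D, W ≤ d ∧ d ∣ ∏ q ∈ Q, q ∧ Real.log d ≤ t * l) ∧
      (W.choose t : ℝ) ≤ (D.filter (fun d => (d * k + 1).Prime)).card * V ^ 14 := by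
  classical
  obtain ⟨C1, hC1, hst⟩ := stage
  refine ⟨C1, hC1, fun P W t l V ht htW hPc hP hV => ?_⟩
  have hC0 := C0_ge
  have hl : 0 ≤ l := by
    obtain ⟨p, hp⟩ : P.Nonempty := Finset.card_pos.1 (by omega)
    exact (Real.log_natCast_nonneg p).trans (hP p hp).2.2
  have ht0 : (0 : ℝ) ≤ t := by positivity
  have htl : 0 ≤ (t + 1) * l := by positivity
  have hV200 : 200 ≤ V := by nlinarith
  obtain ⟨P₁, hP₁, hP₁c⟩ := Finset.exists_subset_card_eq (show W ≤ P.card by omega)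
  obtain ⟨P₂, hP₂, hP₂c⟩ := Finset.exists_subset_card_eq (s := P \ P₁) (n := W) (by
    have := Finset.le_card_sdiff P₁ P; omega)
  set Mo : Finset ℕ → Set ℕ := fun R => {m | 1 ≤ m ∧ Real.log m ≤ (t + 1) * l ∧
    ∀ r, r.Prime → r ∣ m → r ∈ R} with hMo
  have hlogV : ∀ m : ℕ, Real.log m ≤ 2 * ((t + 1) * l) → C1 * (1 + Real.log m) ≤ V := fun m hm =>
    le_trans (mul_le_mul_of_nonneg_left (by linarith) (by linarith)) hV
  have hlogV0 : ∀ m : ℕ, Real.log m ≤ 2 * ((t + 1) * l) → C0 * (1 + Real.log m) ≤ V := fun m hm =>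
    le_trans (mul_le_mul_of_nonneg_right hC1 (by have := Real.log_natCast_nonneg m; linarith)) (hlogV m hm)
  have hchoice : (∀ m ∈ Mo P₁, ∀ [NeZero m], Good V m) ∨ (∀ m ∈ Mo P₂, ∀ [NeZero m], Good V m) := by
    by_contra hcon
    push Not at hcon
    obtain ⟨⟨m₁, hm₁, i₁, hb₁⟩, ⟨m₂, hm₂, i₂, hb₂⟩⟩ := hcon
    have hcop : m₁.Coprime m₂ := by
      refine Nat.coprime_of_dvd fun r hr h1 h2 => ?_
      have a1 := hm₁.2.2 r hr h1
      have a2 := hP₂ (hm₂.2.2 r hr h2)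
      exact (Finset.mem_sdiff.1 a2).2 a1
    have l1 := hm₁.2.1
    have l2 := hm₂.2.1
    have := good_pair hcop (V := V) (hlogV0 m₁ (by linarith)) (hlogV0 m₂ (by linarith)) (hlogV0 _ (by
      rw [Nat.cast_mul, Real.log_mul (by have := hm₁.1; positivity) (by have := hm₂.1; positivity)]
      linarith))
    tauto
  obtain ⟨Q, hQP, hQc, hQg⟩ : ∃ Q ⊆ P, Q.card = W ∧ ∀ m ∈ Mo Q, ∀ [NeZero m], Good V m := by
    rcases hchoice with h | h
    · exact ⟨P₁, hP₁, hP₁c, h⟩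
    · exact ⟨P₂, hP₂.trans Finset.sdiff_subset, hP₂c, h⟩
  have hQpr : ∀ q ∈ Q, q.Prime := fun q hq => (hP q (hQP hq)).1
  set D := (Q.powersetCard t).image (fun T => ∏ q ∈ T, q) with hD
  have hDc : D.card = W.choose t := by
    rw [hD, Finset.card_image_of_injOn, Finset.card_powersetCard, hQc]
    intro A hA B hB hAB
    have hA' := Finset.mem_powersetCard.1 hA
    have hB' := Finset.mem_powersetCard.1 hB
    simp only at hAB
    rw [← Nat.primeFactors_prod (fun p hp => hQpr p (hA'.1 hp)), hAB,
      Nat.primeFactors_prod (fun p hp => hQpr p (hB'.1 hp))]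
  have hDprop : ∀ d ∈ D, 1 ≤ d ∧ W ≤ d ∧ d ∣ ∏ q ∈ Q, q ∧ Real.log d ≤ t * l ∧
      ∀ r, r.Prime → r ∣ d → r ∈ Q := by
    intro d hd
    rw [hD, Finset.mem_image] at hd
    obtain ⟨T, hT, rfl⟩ := hd
    rw [Finset.mem_powersetCard] at hT
    have hpos : 0 < ∏ q ∈ T, q := Finset.prod_pos fun q hq => (hQpr q (hT.1 hq)).pos
    refine ⟨hpos, ?_, Finset.prod_dvd_prod_of_subset _ _ _ hT.1, ?_, ?_⟩
    · obtain ⟨q, hq⟩ : T.Nonempty := Finset.card_pos.1 (by omega)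
      have h1 := Nat.le_of_dvd hpos (Finset.dvd_prod_of_mem (fun q => q) hq)
      have h2 := (hP q (hQP (hT.1 hq))).2.1
      omega
    · rw [Nat.cast_prod, Real.log_prod (fun q hq => by
        have := (hQpr q (hT.1 hq)).pos; positivity)]
      have := Finset.sum_le_card_nsmul T (fun q : ℕ => Real.log q) l (fun q hq => (hP q (hQP (hT.1 hq))).2.2)
      rwa [hT.2, nsmul_eq_mul] at this
    · intro r hr hrd
      rw [hr.prime.dvd_finsetProd_iff] at hrd
      obtain ⟨q, hq, hrq⟩ := hrd
      rw [(Nat.prime_dvd_prime_iff_eq hr (hQpr q (hT.1 hq))).1 hrq]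
      exact hT.1 hq
  have hDne : D.Nonempty := Finset.card_pos.1 (by rw [hDc]; exact Nat.choose_pos htW)
  obtain ⟨k, hk1, hkQ, hkle, hkc⟩ := hst V D Q hV200 hDne
    (fun q hq => ⟨hQpr q hq, by rw [hQc]; exact (hP q (hQP hq)).2.1⟩) (fun d hd => by
      obtain ⟨h1, -, -, h2, h3⟩ := hDprop d hd
      refine ⟨h1, hlogV d (by nlinarith), hQg d ⟨h1, by nlinarith, h3⟩, fun q hq => ?_⟩
      have hqp := hQpr q hq
      have hlq := (hP q (hQP hq)).2.2
      have hlog : Real.log (d * q : ℕ) ≤ (t + 1) * l := by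
        rw [Nat.cast_mul, Real.log_mul (by positivity) (by have := hqp.pos; positivity)]
        linarith
      refine ⟨hlogV _ (by linarith), hQg _ ⟨Nat.mul_pos h1 hqp.pos, hlog, fun r hr hrd => ?_⟩⟩
      rcases hr.dvd_mul.1 hrd with h | h
      · exact h3 r hr h
      · rw [(Nat.prime_dvd_prime_iff_eq hr hqp).1 h]; exact hq)
  refine ⟨Q, hQP, hQc, k, D, hk1, hkQ, hkle, fun d hd => ?_, by rw [← hDc]; exact hkc⟩
  obtain ⟨-, h2, h3, h4, -⟩ := hDprop d hd
  exact ⟨h2, h3, h4⟩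

lemma ev_pow (a : ℝ) (n : ℕ) : ∀ᶠ u : ℕ in Filter.atTop, a * ((u : ℝ) + 1) ^ n ≤ 2 ^ u := by
  have h1 := tendsto_pow_const_div_const_pow_of_one_lt n (r := (2 : ℝ)) (by norm_num)
  have h2 := (Filter.tendsto_add_atTop_iff_nat 1).2 h1
  have hpos : 0 < 1 / (2 * (|a| + 1)) := by positivity
  filter_upwards [h2.eventually_lt_const hpos] with u hu
  rw [div_lt_div_iff₀ (by positivity) (by positivity)] at hu
  push_cast at hu
  rw [pow_succ (2 : ℝ)] at hu
  have h3 : a * ((u : ℝ) + 1) ^ n ≤ (|a| + 1) * ((u : ℝ) + 1) ^ n := by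
    gcongr
    have := le_abs_self a; linarith
  linarith

lemma choose_ge (W t : ℕ) (ht : 1 ≤ t) (htW : 2 * t ≤ W) : (W : ℝ) ^ t ≤ (2 * t) ^ t * W.choose t := by
  have h := Nat.pow_le_choose (α := ℝ) t W
  have hf : (t.factorial : ℝ) ≤ (t : ℝ) ^ t := by exact_mod_cast Nat.factorial_le_pow t
  have h1 : (W : ℝ) / 2 ≤ ((W + 1 - t : ℕ) : ℝ) := by
    rw [Nat.cast_sub (by omega)]
    have : (2 * (t : ℝ)) ≤ W := by exact_mod_cast htW
    push_cast; linarith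
  have h2 : ((W : ℝ) / 2) ^ t ≤ ((W + 1 - t : ℕ) : ℝ) ^ t := by gcongr
  rw [div_pow, div_le_iff₀ (by positivity)] at h2
  rw [div_le_iff₀ (by positivity)] at h
  calc (W : ℝ) ^ t ≤ ((W + 1 - t : ℕ) : ℝ) ^ t * 2 ^ t := h2
    _ ≤ ((W.choose t : ℝ) * t.factorial) * 2 ^ t := by gcongr
    _ ≤ ((W.choose t : ℝ) * t ^ t) * 2 ^ t := by gcongr
    _ = _ := by rw [mul_pow]; ring

lemma prime_count (u : ℕ) (hu1 : 1 ≤ u) (hu : 1000 * ((u : ℝ) + 1) ^ 2 ≤ 2 ^ u) :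
    ∃ P : Finset ℕ, 2 * 2 ^ u ≤ P.card ∧ ∀ p ∈ P, p.Prime ∧ 100 * 2 ^ u ≤ p - 1 ∧ Real.log p ≤ 2 * u := by
  classical
  set x : ℕ := 2 ^ u with hx
  set n : ℕ := x ^ 2 with hn
  have hxR : (x : ℝ) = 2 ^ u := by rw [hx]; push_cast; rfl
  have hu0 : (1 : ℝ) ≤ u := by exact_mod_cast hu1
  have hxb : 1000 * ((u : ℝ) + 1) ^ 2 ≤ x := by rw [hxR]; exact hu
  have hlogn : Real.log n = 2 * u * Real.log 2 := by
    rw [hn]; push_cast; rw [hxR, ← pow_mul, Real.log_pow]; push_cast; ring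
  have hl2 := Real.log_two_gt_d9
  have hl2' := Real.log_two_lt_d9
  have hn1 : (1 : ℝ) ≤ n := by
    rw [hn]; push_cast
    have : (1 : ℝ) ≤ x := by nlinarith
    nlinarith
  have hlogn1 : Real.log (n + 1) ≤ 2 * u + 1 := by
    calc Real.log (n + 1) ≤ Real.log (2 * n) := Real.log_le_log (by positivity) (by linarith)
      _ = Real.log 2 + Real.log n := Real.log_mul (by norm_num) (by positivity)
      _ ≤ _ := by rw [hlogn]; nlinarith
  have hpi := Chebyshev.pi_ge n
  have hpi2 : (102 * x : ℝ) ≤ Nat.primeCounting n := by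
    refine le_trans ?_ hpi
    rw [hlogn, le_div_iff₀ (by positivity)]
    have e : (n : ℝ) = x * x := by rw [hn]; push_cast; ring
    rw [e] at hlogn1 ⊢
    have a1 : 102 * (x : ℝ) * (2 * u * Real.log 2) ≤ 102 * x * (2 * u * 1) := by gcongr; linarith
    have a2 : 1000 * (u : ℝ) ≤ x := by nlinarith
    have a3 : (x : ℝ) * (1000 * u) ≤ x * x := by gcongr
    have a4 : (x : ℝ) * x * (1/2) ≤ x * x * Real.log 2 := by gcongr; linarith
    have a5 : (1 : ℝ) * (1000 * u) ≤ x * u * 1000 := by nlinarith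
    nlinarith
  have hpi3 : 102 * x ≤ Nat.primeCounting n := by exact_mod_cast hpi2
  refine ⟨((Finset.range (n + 1)).filter Nat.Prime) \ (Finset.Icc 1 (100 * x)), ?_, ?_⟩
  · have := Finset.le_card_sdiff (Finset.Icc 1 (100 * x)) ((Finset.range (n + 1)).filter Nat.Prime)
    rw [Nat.card_Icc] at this
    have h5 : Nat.primeCounting n = ((Finset.range (n + 1)).filter Nat.Prime).card := by
      rw [Nat.primeCounting, Nat.primeCounting', Nat.count_eq_card_filter_range]
    omega
  · intro p hp
    rw [Finset.mem_sdiff, Finset.mem_filter, Finset.mem_range, Finset.mem_Icc] at hp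
    have := hp.1.2.pos
    refine ⟨hp.1.2, by omega, ?_⟩
    calc Real.log p ≤ Real.log n := Real.log_le_log (by positivity) (by
          have : p ≤ n := by omega
          exact_mod_cast this)
      _ ≤ _ := by rw [hlogn]; nlinarith

end Carm

namespace Carm
open Complex

lemma exp_final (u x : ℕ) (hu1 : 1 ≤ u) (hx : 1000 * (u + 1) ^ 2 ≤ x) :
    3 + 4 * u + 6 * x * (2 * u + 1) * (4 * u + 1) + 56 * u + (1 + 2 * u) * x ^ 2 ≤ 4 * u * x ^ 2 := by
  have h1 : x ^ 2 + (1 + 2 * u) * x ^ 2 ≤ 4 * u * x ^ 2 := by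
    have : 1 + (1 + 2 * u) ≤ 4 * u := by omega
    calc x ^ 2 + (1 + 2 * u) * x ^ 2 = (1 + (1 + 2 * u)) * x ^ 2 := by ring
      _ ≤ _ := Nat.mul_le_mul_right _ this
  have h2 : 1000 * (u + 1) ^ 2 * x ≤ x ^ 2 := by
    rw [pow_two x]; exact Nat.mul_le_mul_right _ hx
  have h3 : 6 * x * (2 * u + 1) * (4 * u + 1) ≤ 48 * (u + 1) ^ 2 * x := by
    have : (2 * u + 1) * (4 * u + 1) ≤ 8 * (u + 1) ^ 2 := by nlinarith
    calc 6 * x * (2 * u + 1) * (4 * u + 1) = 6 * x * ((2 * u + 1) * (4 * u + 1)) := by ring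
      _ ≤ 6 * x * (8 * (u + 1) ^ 2) := Nat.mul_le_mul_left _ this
      _ = _ := by ring
  have h4 : 3 + 60 * u ≤ 900 * (u + 1) ^ 2 * x := by nlinarith
  have h5 : 48 * (u + 1) ^ 2 * x + 900 * (u + 1) ^ 2 * x ≤ 1000 * (u + 1) ^ 2 * x := by nlinarith
  omega

lemma final_count (u x N M c : ℕ) (hu1 : 1 ≤ u) (hxu : x = 2 ^ u) (hx : 1000 * (u + 1) ^ 2 ≤ x)
    (hM : M ≤ 4 ^ (x * (1 + 2 * u))) (hc : (x ^ 4) ^ (x ^ 2) ≤ (2 * x ^ 2) ^ (x ^ 2) * c)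
    (hN : c ≤ N * (x ^ 4) ^ 14) : 4 * (M ^ (4 * u + 1)) ^ 3 + x ^ 4 ≤ N := by
  by_contra hcon
  push Not at hcon
  have hMp : 4 * (M ^ (4 * u + 1)) ^ 3 ≤ 2 ^ (2 + 6 * x * (2 * u + 1) * (4 * u + 1)) := by
    calc _ ≤ 4 * ((4 ^ (x * (1 + 2 * u))) ^ (4 * u + 1)) ^ 3 := by gcongr
      _ = _ := by
        rw [show (4 : ℕ) = 2 ^ 2 by norm_num]
        simp only [← pow_mul, ← pow_add]
        congr 1; ring
  have hx4 : x ^ 4 = 2 ^ (4 * u) := by rw [hxu, ← pow_mul]; congr 1; ring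
  have hsum : 4 * (M ^ (4 * u + 1)) ^ 3 + x ^ 4 ≤ 2 ^ (3 + 4 * u + 6 * x * (2 * u + 1) * (4 * u + 1)) := by
    set e := 6 * x * (2 * u + 1) * (4 * u + 1) with he
    have a1 : 2 ^ (2 + e) ≤ 2 ^ (2 + 4 * u + e) := Nat.pow_le_pow_right (by norm_num) (by omega)
    have a2 : 2 ^ (4 * u) ≤ 2 ^ (2 + 4 * u + e) := Nat.pow_le_pow_right (by norm_num) (by omega)
    have a3 : 2 ^ (3 + 4 * u + e) = 2 * 2 ^ (2 + 4 * u + e) := by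
      rw [← pow_succ']; congr 1; omega
    rw [hx4, a3]
    linarith
  have hxpos : 0 < x := by rw [hxu]; positivity
  have h1 : (x ^ 4) ^ (x ^ 2) < 2 ^ (4 * u * x ^ 2) := by
    calc (x ^ 4) ^ (x ^ 2) ≤ (2 * x ^ 2) ^ (x ^ 2) * (N * (x ^ 4) ^ 14) :=
          hc.trans (Nat.mul_le_mul_left _ hN)
      _ < (2 * x ^ 2) ^ (x ^ 2) * (2 ^ (3 + 4 * u + 6 * x * (2 * u + 1) * (4 * u + 1)) * (x ^ 4) ^ 14) := by
        gcongr
        exact hcon.trans_le hsum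
      _ = 2 ^ (3 + 4 * u + 6 * x * (2 * u + 1) * (4 * u + 1) + 56 * u + (1 + 2 * u) * x ^ 2) := by
        have : 2 * x ^ 2 = 2 ^ (1 + 2 * u) := by rw [hxu, ← pow_mul, pow_add]; congr 1; rw [mul_comm]
        rw [this, hx4]
        simp only [← pow_mul, ← pow_add]
        congr 1; ring
      _ ≤ _ := Nat.pow_le_pow_right (by norm_num) (exp_final u x hu1 hx)
  rw [hx4, ← pow_mul] at h1
  exact lt_irrefl _ h1

lemma choose_ge_nat (W t : ℕ) (ht : 1 ≤ t) (h : 2 * t ≤ W) :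
    W ^ t ≤ (2 * t) ^ t * W.choose t := by
  have := choose_ge W t ht h
  exact_mod_cast this

lemma two_mul_sq_le (x : ℕ) (hx : 2 ≤ x) : 2 * x ^ 2 ≤ x ^ 4 := by
  calc 2 * x ^ 2 ≤ x ^ 2 * x ^ 2 := Nat.mul_le_mul_right _ (by nlinarith)
    _ = _ := by ring

lemma cast_bound (c N x : ℕ) (h : (c : ℝ) ≤ N * ((x : ℝ) ^ 4) ^ 14) : c ≤ N * (x ^ 4) ^ 14 := by
  exact_mod_cast h

set_option maxHeartbeats 1000000 in
theorem main_exists (B : ℕ) :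
    ∃ n, B ≤ n ∧ IsCarmichael n ∧ ∃ m : ℕ, n.primeFactors.card = m ^ 2 := by
  classical
  obtain ⟨C1, hC1, hst⟩ := stage'
  have hC0 := C0_ge
  have hC1p : 0 < C1 := by linarith
  obtain ⟨u, huB, ha, hb, hc, hd⟩ := ((Filter.eventually_ge_atTop (B + 1)).and ((ev_pow 1000 2).and
    ((ev_pow (103 * 12 ^ 6 * (29 * C1) ^ 14) 14).and
    ((ev_pow ((29 * C1) ^ 26 + 13) 26).and (ev_pow (5 * C1) 0))))).exists
  have hu1 : 1 ≤ u := by omega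
  have huR : (1 : ℝ) ≤ u := by exact_mod_cast hu1
  obtain ⟨x, hx⟩ : ∃ x : ℕ, x = 2 ^ u := ⟨_, rfl⟩
  have hxR : (2 : ℝ) ^ u = x := by rw [hx]; push_cast; rfl
  obtain ⟨P, hPc, hP⟩ := prime_count u hu1 ha
  rw [← hx] at hPc hP
  rw [hxR] at ha hb hc hd
  rw [pow_zero, mul_one] at hd
  have hxN : 1000 * (u + 1) ^ 2 ≤ x := by exact_mod_cast ha
  have hx1000 : 1000 ≤ x := by nlinarith
  have hx1000R : (1000 : ℝ) ≤ x := by exact_mod_cast hx1000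
  obtain ⟨V, hV⟩ : ∃ V : ℝ, V = C1 * (1 + 2 * (((6 : ℕ) + 1) * (2 * u))) := ⟨_, rfl⟩
  have hVle : V ≤ 29 * C1 * (u + 1) := by rw [hV]; push_cast; nlinarith
  have hV0 : 0 < V := by rw [hV]; positivity
  have hV14 : 103 * 12 ^ 6 * V ^ 14 ≤ x := by
    refine le_trans ?_ hb
    calc _ ≤ 103 * 12 ^ 6 * (29 * C1 * (u + 1)) ^ 14 := by gcongr
      _ = _ := by rw [mul_pow (29 * C1)]; ring
  have hV26 : V ^ 26 + 12 * u + 1 ≤ x := by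
    refine le_trans ?_ hc
    have h1 : V ^ 26 ≤ (29 * C1) ^ 26 * ((u : ℝ) + 1) ^ 26 := by
      rw [← mul_pow]; gcongr
    have h2 : (u : ℝ) + 1 ≤ ((u : ℝ) + 1) ^ 26 := le_self_pow₀ (by linarith) (by norm_num)
    rw [add_mul]
    linarith
  obtain ⟨Q₁, hQ₁P, hQ₁c, k₁, D₁, hk₁, -, hk₁le, hD₁, hN₁⟩ :=
    hst P x 6 (2 * u) V (by norm_num) (by omega) hPc hP hV.ge
  set F₁ := D₁.filter (fun d => (d * k₁ + 1).Prime) with hF₁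
  have hF₁c : 103 * x ^ 4 ≤ F₁.card := by
    have h1 := choose_ge x 6 (by norm_num) (by omega)
    have h2 : (x : ℝ) ^ 6 ≤ (2 * (6 : ℕ)) ^ 6 * (F₁.card * V ^ 14) := h1.trans (by gcongr)
    have h3 : 103 * (x : ℝ) ^ 6 ≤ F₁.card * x := by
      calc 103 * (x : ℝ) ^ 6 ≤ 103 * ((2 * (6 : ℕ)) ^ 6 * (F₁.card * V ^ 14)) := by gcongr
        _ = F₁.card * (103 * 12 ^ 6 * V ^ 14) := by push_cast; norm_num; ring
        _ ≤ _ := by gcongr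
    have h4 : 103 * x ^ 6 ≤ F₁.card * x := by exact_mod_cast h3
    have h5 : 103 * x ^ 5 ≤ F₁.card := by
      refine Nat.le_of_mul_le_mul_right (c := x) ?_ (by omega)
      calc 103 * x ^ 5 * x = 103 * x ^ 6 := by ring
        _ ≤ _ := h4
    refine le_trans (Nat.mul_le_mul_left _ (Nat.pow_le_pow_right (by omega) (by norm_num))) h5
  set M := k₁ * ∏ q ∈ Q₁, q with hM
  have hinj : Function.Injective (fun d : ℕ => d * k₁ + 1) := by
    intro a b hab
    have : a * k₁ = b * k₁ := by simpa using hab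
    exact Nat.eq_of_mul_eq_mul_right hk₁ this
  set P₂ := (F₁.image (fun d => d * k₁ + 1)) \ Finset.Icc 1 (100 * x ^ 4) with hP₂
  have hP₂c : 2 * x ^ 4 ≤ P₂.card := by
    have h1 := Finset.le_card_sdiff (Finset.Icc 1 (100 * x ^ 4)) (F₁.image (fun d => d * k₁ + 1))
    rw [Finset.card_image_of_injective _ hinj, Nat.card_Icc] at h1
    rw [hP₂]; omega
  have hP₂p : ∀ q ∈ P₂, (q.Prime ∧ 100 * x ^ 4 ≤ q - 1 ∧ Real.log q ≤ x) ∧ q - 1 ∣ M := by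
    intro q hq
    rw [hP₂, Finset.mem_sdiff, Finset.mem_image, Finset.mem_Icc] at hq
    obtain ⟨⟨d, hd', rfl⟩, hq2⟩ := hq
    rw [hF₁, Finset.mem_filter] at hd'
    obtain ⟨hdD, hdp⟩ := hd'
    obtain ⟨hd1, hd2, hd3⟩ := hD₁ d hdD
    refine ⟨⟨hdp, by omega, ?_⟩, ?_⟩
    · have hd0 : (1 : ℝ) ≤ d := by
        have : 1 ≤ d := by omega
        exact_mod_cast this
      have hk0 : (1 : ℝ) ≤ k₁ := by exact_mod_cast hk₁
      have h1 : Real.log ((d * k₁ + 1 : ℕ) : ℝ) ≤ Real.log (2 * (d * k₁)) := by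
        apply Real.log_le_log (by positivity)
        push_cast; nlinarith
      rw [Real.log_mul (by norm_num) (by positivity), Real.log_mul (by positivity) (by positivity)] at h1
      have h2 : Real.log k₁ ≤ V ^ 26 := by
        rw [Real.log_le_iff_le_exp (by positivity)]; exact hk₁le
      have h3 := Real.log_two_lt_d9
      push_cast at hd3
      linarith
    · rw [Nat.add_sub_cancel, hM, mul_comm]
      exact Nat.mul_dvd_mul_left _ hd2
  have hMle : M ≤ 4 ^ (x * (1 + 2 * u)) := by
    have h1 : ((∏ q ∈ Q₁, q : ℕ) : ℝ) ≤ Real.exp (x * (2 * u)) := by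
      rw [Nat.cast_prod]
      calc ∏ q ∈ Q₁, (q : ℝ) ≤ ∏ q ∈ Q₁, Real.exp (2 * u) := by
            refine Finset.prod_le_prod (fun q _ => by positivity) fun q hq => ?_
            have h2 := hP q (hQ₁P hq)
            have := h2.1.pos
            rw [← Real.log_le_iff_le_exp (by positivity)]
            exact h2.2.2
        _ = _ := by rw [Finset.prod_const, hQ₁c, ← Real.exp_nat_mul]
    have h2 : (k₁ : ℝ) ≤ Real.exp x := hk₁le.trans (Real.exp_le_exp.2 (by linarith))
    have h3 : (M : ℝ) ≤ 4 ^ (x * (1 + 2 * u)) := by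
      calc (M : ℝ) = k₁ * ((∏ q ∈ Q₁, q : ℕ) : ℝ) := by rw [hM, Nat.cast_mul]
        _ ≤ Real.exp x * Real.exp (x * (2 * u)) := by gcongr
        _ = (Real.exp 1) ^ (x * (1 + 2 * u)) := by
          rw [← Real.exp_add, ← Real.exp_nat_mul]; congr 1; push_cast; ring
        _ ≤ _ := by
          gcongr
          have := Real.exp_one_lt_d9; linarith
    exact_mod_cast h3
  have hMpos : 1 ≤ M := by
    rw [hM]
    exact Nat.mul_pos hk₁ (Finset.prod_pos fun q hq => (hP q (hQ₁P hq)).1.pos)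
  obtain ⟨Q₂, hQ₂P, hQ₂c, k₂, D₂, hk₂, hk₂Q, -, hD₂, hN₂⟩ :=
    hst P₂ (x ^ 4) (x ^ 2) x ((x : ℝ) ^ 4) (Nat.one_le_pow _ _ (by omega))
      (Nat.pow_le_pow_right (by omega) (by norm_num)) hP₂c (fun q hq => (hP₂p q hq).1) (by
        push_cast
        calc C1 * (1 + 2 * (((x : ℝ) ^ 2 + 1) * x)) ≤ C1 * (5 * (x : ℝ) ^ 3) := by
              refine mul_le_mul_of_nonneg_left ?_ hC1p.le
              have e1 : (x : ℝ) ≤ (x : ℝ) ^ 3 := le_self_pow₀ (by linarith) (by norm_num)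
              have e2 : 1 + 2 * (((x : ℝ) ^ 2 + 1) * x) = 1 + 2 * (x : ℝ) ^ 3 + 2 * x := by ring
              linarith
          _ = (5 * C1) * (x : ℝ) ^ 3 := by ring
          _ ≤ x * (x : ℝ) ^ 3 := by gcongr
          _ = _ := by ring)
  have hcount := final_count u x (D₂.filter (fun d => (d * k₂ + 1).Prime)).card M ((x ^ 4).choose (x ^ 2))
    hu1 hx hxN hMle (choose_ge_nat _ _ (Nat.one_le_pow _ _ (by omega)) (two_mul_sq_le x (by omega)))
      (cast_bound _ _ _ hN₂)
  refine combine Q₂ M hMpos (fun q hq => ⟨(hP₂p q (hQ₂P hq)).1.1, (hP₂p q (hQ₂P hq)).2⟩) (4 * u)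
    (by rw [hQ₂c, hx, ← pow_mul, mul_comm]) k₂ hk₂Q B D₂ (fun d hd' => ⟨?_, (hD₂ d hd').2.1⟩) hk₂ (by
      rw [hQ₂c]; exact hcount)
  have h1 := (hD₂ d hd').1
  have h2 : x ≤ x ^ 4 := Nat.le_self_pow (by norm_num) x
  have h3 : u < x := by rw [hx]; exact Nat.lt_two_pow_self
  omega

end Carm

theorem infinite_carmichael_square_omega :
    {n : ℕ | IsCarmichael n ∧ ∃ m : ℕ, n.primeFactors.card = m ^ 2}.Infinite := by
  refine Set.infinite_of_forall_exists_gt fun B => ?_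
  obtain ⟨n, hn, h1, h2⟩ := Carm.main_exists (B + 1)
  exact ⟨n, ⟨h1, h2⟩, by omega⟩
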